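/- arXiv:1201.2993 — 2 statements merged into one kernel-verified Lean document; each statement's English description precedes it below -/
import Mathlib

section
/- Let n ≥ 1, Q = 2n+2, Q' = Q/(Q−1), τ > 0, 0 ≤ β < Q, and α > α_Q(1 − β/Q). Then for every constant C > 0 there exists u ∈ C_c^∞(ℝ^{2n+1}) with ∫_{ℍ^n} (|∇_H u|^Q + τ|u|^Q) dξ ≤ 1 and ∫_{ℍ^n} |ξ|_h^{−β} ζ(Q, α|u|^{Q'}) dξ > C; that is, the supremum of the singular Trudinger–Moser functional over the unit ball of the norm ‖u‖_{1,τ} = (∫(|∇_H u|^Q + τ|u|^Q)dξ)^{1/Q} is infinite. -/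
open MeasureTheory Real ENNReal

noncomputable section

/-- The Heisenberg group `ℍ^n` as the underlying space `ℝ^n × ℝ^n × ℝ`. -/
abbrev Heis (n : ℕ) := (Fin n → ℝ) × (Fin n → ℝ) × ℝ

/-- Heisenberg group law: `(x,y,t)∘(x',y',t') = (x+x', y+y', t+t'+2(⟨y,x'⟩−⟨x,y'⟩))`. -/
def hMul {n : ℕ} (ξ η : Heis n) : Heis n :=
  (ξ.1 + η.1, ξ.2.1 + η.2.1,
    ξ.2.2 + η.2.2 + 2 * ((∑ i, ξ.2.1 i * η.1 i) - ∑ i, ξ.1 i * η.2.1 i))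

/-- Homogeneous norm `|ξ|_h = ((|x|²+|y|²)² + t²)^{1/4}`. -/
def hNorm {n : ℕ} (ξ : Heis n) : ℝ :=
  ((∑ i, ((ξ.1 i) ^ 2 + (ξ.2.1 i) ^ 2)) ^ 2 + (ξ.2.2) ^ 2) ^ ((1 : ℝ) / 4)

/-- Heisenberg distance `d_h(ξ,η) = |η⁻¹∘ξ|_h`, where `η⁻¹ = -η`. -/
def hDist {n : ℕ} (ξ η : Heis n) : ℝ := hNorm (hMul (-η) ξ)

/-- Heisenberg ball `B_h(ξ,r) = {η : d_h(η,ξ) < r}`. -/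
def hBall {n : ℕ} (ξ : Heis n) (r : ℝ) : Set (Heis n) := {η | hDist η ξ < r}

/-- Left-invariant vector field `X_i u = ∂u/∂x_i + 2 y_i ∂u/∂t`. -/
def Xd {n : ℕ} (u : Heis n → ℝ) (i : Fin n) (ξ : Heis n) : ℝ :=
  fderiv ℝ u ξ (Pi.single i 1, 0, 0) + 2 * ξ.2.1 i * fderiv ℝ u ξ (0, 0, 1)

/-- Left-invariant vector field `Y_i u = ∂u/∂y_i − 2 x_i ∂u/∂t`. -/
def Yd {n : ℕ} (u : Heis n → ℝ) (i : Fin n) (ξ : Heis n) : ℝ :=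
  fderiv ℝ u ξ (0, Pi.single i 1, 0) - 2 * ξ.1 i * fderiv ℝ u ξ (0, 0, 1)

/-- Norm of the sub-elliptic gradient `|∇_H u| = (Σ ((X_i u)² + (Y_i u)²))^{1/2}`. -/
def hGradNorm {n : ℕ} (u : Heis n → ℝ) (ξ : Heis n) : ℝ :=
  Real.sqrt (∑ i, ((Xd u i ξ) ^ 2 + (Yd u i ξ) ^ 2))

/-- `ζ(Q,s) = e^s − Σ_{k=0}^{Q−2} s^k/k!`. -/
def zeta (Q : ℕ) (s : ℝ) : ℝ :=
  Real.exp s - ∑ k ∈ Finset.range (Q - 1), s ^ k / (Nat.factorial k)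

/-- Surface area of the unit sphere in `ℝ^{2n}`: `ω_{2n-1} = 2π^n/(n-1)!`. -/
def omegaSphere (n : ℕ) : ℝ := 2 * Real.pi ^ n / (Nat.factorial (n - 1))

/-- `σ_Q = Γ(1/2) Γ(n+1/2) ω_{2n-1} / n!`. -/
def sigmaQ (n : ℕ) : ℝ :=
  Real.Gamma (1 / 2) * Real.Gamma (n + 1 / 2) * omegaSphere n / (Nat.factorial n)

/-- `α_Q = Q σ_Q^{1/(Q-1)}` with `Q = 2n+2`. -/
def alphaQ (n : ℕ) : ℝ := (2 * n + 2) * (sigmaQ n) ^ ((1 : ℝ) / (2 * n + 1))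

theorem lintegral_fun_norm_addHaar {E : Type*} [NormedAddCommGroup E] [NormedSpace ℝ E]
    [MeasurableSpace E] [BorelSpace E] [FiniteDimensional ℝ E] [Nontrivial E]
    (μ : Measure E) [μ.IsAddHaarMeasure] {f : ℝ → ℝ≥0∞} (hf : Measurable f) :
    ∫⁻ x, f ‖x‖ ∂μ = Module.finrank ℝ E * μ (Metric.ball 0 1) *
      ∫⁻ r in Set.Ioi (0 : ℝ), ENNReal.ofReal (r ^ (Module.finrank ℝ E - 1)) * f r := by
  calc
    ∫⁻ x, f ‖x‖ ∂μ = ∫⁻ x : ({0}ᶜ : Set E), f ‖x.1‖ ∂(μ.comap (↑)) := by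
      rw [lintegral_subtype_comap (measurableSet_singleton _).compl fun x ↦ f ‖x‖,
        restrict_compl_singleton]
    _ = ∫⁻ x, f x.2 ∂μ.toSphere.prod (.volumeIoiPow (Module.finrank ℝ E - 1)) := by
      simpa using μ.measurePreserving_homeomorphUnitSphereProd.lintegral_comp_emb
        (Homeomorph.measurableEmbedding _) (f ∘ Subtype.val ∘ Prod.snd)
    _ = μ.toSphere Set.univ *
        ∫⁻ x : Set.Ioi (0 : ℝ), f x ∂.volumeIoiPow (Module.finrank ℝ E - 1) := by
      rw [lintegral_prod _ (by fun_prop)]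
      simp [mul_comm]
    _ = _ := by
      rw [Measure.volumeIoiPow, lintegral_withDensity_eq_lintegral_mul _ (by fun_prop)
        (by fun_prop), μ.toSphere_apply_univ,
        ← lintegral_subtype_comap measurableSet_Ioi]
      rfl

theorem lintegral_sq_norm_prod (n : ℕ) (hn : 1 ≤ n) {f : ℝ → ℝ≥0∞} (hf : Measurable f) :
    ∫⁻ z : (Fin n → ℝ) × (Fin n → ℝ), f (∑ i, (z.1 i ^ 2 + z.2 i ^ 2)) =
      ENNReal.ofReal (π ^ n / (n - 1).factorial) *
        ∫⁻ s in Set.Ioi (0 : ℝ), ENNReal.ofReal (s ^ (n - 1)) * f s := by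
  obtain ⟨m, rfl⟩ : ∃ m, n = m + 1 := ⟨n - 1, by omega⟩
  have e1 := (volume_measurePreserving_sumPiEquivProdPi_symm
    (fun _ : Fin (m + 1) ⊕ Fin (m + 1) => ℝ)).lintegral_comp_emb
      (MeasurableEquiv.measurableEmbedding _) (fun w => f (∑ i, w i ^ 2))
  have e2 := (PiLp.volume_preserving_ofLp (Fin (m + 1) ⊕ Fin (m + 1))).lintegral_comp_emb
      ((MeasurableEquiv.toLp 2 _).symm.measurableEmbedding) (fun w => f (∑ i, w i ^ 2))
  have e3 := lintegral_fun_norm_addHaar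
    (volume : Measure (EuclideanSpace ℝ (Fin (m + 1) ⊕ Fin (m + 1)))) (f := fun r => f (r ^ 2))
    (by fun_prop)
  have e4 : ∫⁻ s in Set.Ioi (0 : ℝ), ENNReal.ofReal (s ^ m) * f s =
      2 * ∫⁻ r in Set.Ioi (0 : ℝ), ENNReal.ofReal (r ^ (2 * m + 1)) * f (r ^ 2) := by
    have him : (fun r : ℝ => r ^ 2) '' Set.Ioi 0 = Set.Ioi 0 := by
      ext s
      constructor
      · rintro ⟨r, hr, rfl⟩
        exact pow_pos (Set.mem_Ioi.1 hr) 2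
      · intro hs
        exact ⟨√s, Real.sqrt_pos.2 hs, Real.sq_sqrt (Set.mem_Ioi.1 hs).le⟩
    have h := lintegral_image_eq_lintegral_abs_deriv_mul (f := fun r : ℝ => r ^ 2)
      (f' := fun r => 2 * r) (s := Set.Ioi 0) measurableSet_Ioi
      (fun x _ => by simpa using (hasDerivAt_pow 2 x).hasDerivWithinAt)
      (fun x hx y hy hxy => by
        simpa [abs_of_pos (Set.mem_Ioi.1 hx), abs_of_pos (Set.mem_Ioi.1 hy)] using
          (sq_eq_sq_iff_abs_eq_abs x y).1 hxy)
      (fun s => ENNReal.ofReal (s ^ m) * f s)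
    rw [him] at h
    rw [h, ← lintegral_const_mul _ (by fun_prop)]
    refine setLIntegral_congr_fun measurableSet_Ioi fun r hr => ?_
    have hr : (0 : ℝ) < r := hr
    rw [abs_of_pos (by positivity), ENNReal.ofReal_mul (by norm_num), ← mul_assoc, ← mul_assoc,
      mul_assoc (ENNReal.ofReal 2), ← ENNReal.ofReal_mul hr.le]
    congr 2
    · simp
    · congr 1; ring
  have e5 : (fun z : (Fin (m + 1) → ℝ) × (Fin (m + 1) → ℝ) =>
      f (∑ i, (z.1 i ^ 2 + z.2 i ^ 2))) = fun z => f (∑ i, ((MeasurableEquiv.sumPiEquivProdPi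
        (fun _ : Fin (m + 1) ⊕ Fin (m + 1) => ℝ)).symm z) i ^ 2) := by
    ext z
    rw [Fintype.sum_sum_type, Finset.sum_add_distrib]
    rfl
  rw [e5, Measure.volume_eq_prod] at *
  rw [e1, ← e2]
  simp only [EuclideanSpace.norm_sq_eq, Real.norm_eq_abs, sq_abs] at e3
  rw [e3, EuclideanSpace.volume_ball]
  simp only [Nat.add_sub_cancel, finrank_euclideanSpace, Fintype.card_sum, Fintype.card_fin]
  rw [e4, ← mul_assoc _ 2, show m + 1 + (m + 1) - 1 = 2 * m + 1 by omega]
  congr 1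
  rw [← ENNReal.ofReal_ofNat 2, ← ENNReal.ofReal_mul (by positivity), ← ENNReal.ofReal_natCast, ENNReal.ofReal_one, one_pow, one_mul,
    ← ENNReal.ofReal_mul (by positivity)]
  congr 1
  rw [show ((m + 1 + (m + 1) : ℕ) : ℝ) / 2 + 1 = ((m + 1 : ℕ) : ℝ) + 1 by push_cast; ring,
    Real.Gamma_nat_eq_factorial, ← two_mul, pow_mul, Real.sq_sqrt pi_pos.le, Nat.factorial_succ]
  have : (m.factorial : ℝ) ≠ 0 := by positivity
  push_cast
  field_simp

theorem integral_cos_pow_even_eq_Gamma (n : ℕ) :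
    ∫ θ in (-(π / 2))..(π / 2), cos θ ^ (2 * n) =
      Real.Gamma (1 / 2) * Real.Gamma (n + 1 / 2) / n.factorial := by
  have h1 : ∫ θ in (-(π / 2))..(π / 2), cos θ ^ (2 * n) = ∫ θ in 0..π, sin θ ^ (2 * n) := by
    have := intervalIntegral.integral_comp_sub_right (a := 0) (b := π)
      (fun θ => cos θ ^ (2 * n)) (π / 2)
    simp only [Real.cos_sub_pi_div_two] at this
    rw [this]
    congr 1 <;> ring
  rw [h1, integral_sin_pow_even]
  clear h1
  induction n with
  | zero => simp [Real.Gamma_one_half_eq, -one_div, Real.mul_self_sqrt pi_pos.le]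
  | succ k ih =>
    rw [Finset.prod_range_succ, ← mul_assoc, ih, Nat.factorial_succ,
      show ((k + 1 : ℕ) : ℝ) + 1 / 2 = (k + 1 / 2 : ℝ) + 1 by push_cast; ring,
      Real.Gamma_add_one (by positivity)]
    push_cast
    field_simp

set_option maxHeartbeats 1000000 in
theorem lintegral_polar_annulus (n : ℕ) (hn : 1 ≤ n) {a b : ℝ} (ha : 0 < a) (hab : a ≤ b) :
    ∫⁻ t : ℝ, ∫⁻ s in Set.Ioi (0 : ℝ), ENNReal.ofReal (s ^ (n - 1)) *
      (if a ≤ s ^ 2 + t ^ 2 ∧ s ^ 2 + t ^ 2 ≤ b then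
        ENNReal.ofReal ((s / (s ^ 2 + t ^ 2)) ^ (n + 1)) else 0) =
    ENNReal.ofReal (Real.Gamma (1 / 2) * Real.Gamma (n + 1 / 2) / n.factorial *
      (Real.log (b / a) / 2)) := by
  set F : ℝ × ℝ → ℝ≥0∞ := fun p => if 0 < p.1 then
    ENNReal.ofReal (p.1 ^ (n - 1)) * (if a ≤ p.1 ^ 2 + p.2 ^ 2 ∧ p.1 ^ 2 + p.2 ^ 2 ≤ b then
      ENNReal.ofReal ((p.1 / (p.1 ^ 2 + p.2 ^ 2)) ^ (n + 1)) else 0) else 0 with hF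
  have hFm : Measurable F := by
    refine Measurable.ite (measurableSet_lt measurable_const measurable_fst) ?_ measurable_const
    have hN : Measurable fun p : ℝ × ℝ => p.1 ^ 2 + p.2 ^ 2 := by fun_prop
    refine Measurable.mul (by fun_prop) (Measurable.ite ?_ (by fun_prop) measurable_const)
    exact (measurableSet_le measurable_const hN).inter (measurableSet_le hN measurable_const)
  have h1 : ∀ t : ℝ, ∫⁻ s in Set.Ioi (0 : ℝ), ENNReal.ofReal (s ^ (n - 1)) *
      (if a ≤ s ^ 2 + t ^ 2 ∧ s ^ 2 + t ^ 2 ≤ b then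
        ENNReal.ofReal ((s / (s ^ 2 + t ^ 2)) ^ (n + 1)) else 0) = ∫⁻ s, F (s, t) := by
    intro t
    rw [← lintegral_indicator measurableSet_Ioi]
    rfl
  simp_rw [h1]
  rw [← lintegral_prod_symm _ hFm.aemeasurable, ← Measure.volume_eq_prod,
    ← lintegral_comp_polarCoord_symm, polarCoord_target, Measure.volume_eq_prod,
    ← Measure.prod_restrict]
  have h2 : ∀ p ∈ (Set.Ioi (0 : ℝ)) ×ˢ (Set.Ioo (-π) π),
      ENNReal.ofReal p.1 • F (polarCoord.symm p) =
      ((Set.Icc (√a) (√b)).indicator (fun r => ENNReal.ofReal r⁻¹) p.1) *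
      ((Set.Ioc (-(π / 2)) (π / 2)).indicator (fun θ => ENNReal.ofReal (cos θ ^ (2 * n))) p.2) := by
    rintro ⟨r, θ⟩ ⟨hr, hθ⟩
    simp only [Set.mem_Ioi, Set.mem_Ioo] at hr hθ
    have hN : (r * cos θ) ^ 2 + (r * sin θ) ^ 2 = r ^ 2 := by
      linear_combination r ^ 2 * Real.cos_sq_add_sin_sq θ
    simp only [polarCoord_symm_apply, hF, hN, smul_eq_mul]
    by_cases hcos : 0 < cos θ
    · have hmem : θ ∈ Set.Ioc (-(π / 2)) (π / 2) := by
        by_contra hc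
        rw [Set.mem_Ioc, not_and_or, not_lt, not_le] at hc
        rcases hc with hc | hc
        · have := Real.cos_nonpos_of_pi_div_two_le_of_le (x := -θ) (by linarith) (by linarith)
          rw [Real.cos_neg] at this
          linarith
        · linarith [Real.cos_nonpos_of_pi_div_two_le_of_le hc.le (by linarith)]
      have hab' : (a ≤ r ^ 2 ∧ r ^ 2 ≤ b) ↔ r ∈ Set.Icc (√a) (√b) := by
        rw [Set.mem_Icc, Real.sqrt_le_left hr.le, Real.le_sqrt' hr]
      rw [if_pos (by positivity), Set.indicator_of_mem hmem]
      by_cases h : r ∈ Set.Icc (√a) (√b)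
      · rw [if_pos (hab'.2 h), Set.indicator_of_mem h, ← ENNReal.ofReal_mul (by positivity),
          ← ENNReal.ofReal_mul (by positivity), ← ENNReal.ofReal_mul (by positivity)]
        congr 1
        obtain ⟨m, rfl⟩ : ∃ m, n = m + 1 := ⟨n - 1, by omega⟩
        simp only [Nat.add_sub_cancel]
        have : r ≠ 0 := hr.ne'
        rw [show r * cos θ / r ^ 2 = cos θ / r by field_simp]
        simp only [div_pow, mul_pow]
        field_simp
        ring
      · rw [if_neg (fun h' => h (hab'.1 h')), Set.indicator_of_notMem h]
        simp
    · rw [if_neg (by nlinarith)]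
      by_cases hmem : θ ∈ Set.Ioc (-(π / 2)) (π / 2)
      · have : cos θ = 0 := le_antisymm (not_lt.1 hcos)
          (Real.cos_nonneg_of_mem_Icc ⟨hmem.1.le, hmem.2⟩)
        simp [this, show n ≠ 0 by omega]
      · simp [Set.indicator_of_notMem hmem]
  rw [Measure.prod_restrict, setLIntegral_congr_fun (by measurability) h2,
    ← Measure.prod_restrict, lintegral_prod_mul
      (f := (Set.Icc (√a) (√b)).indicator (fun r => ENNReal.ofReal r⁻¹))
      (g := (Set.Ioc (-(π / 2)) (π / 2)).indicator (fun θ => ENNReal.ofReal (cos θ ^ (2 * n))))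
      (Measurable.indicator (by fun_prop) measurableSet_Icc).aemeasurable
      (Measurable.indicator (by fun_prop) measurableSet_Ioc).aemeasurable,
    setLIntegral_indicator measurableSet_Icc, setLIntegral_indicator measurableSet_Ioc,
    Set.inter_eq_left.2 (show Set.Icc (√a) (√b) ⊆ Set.Ioi 0 from
      fun x hx => lt_of_lt_of_le (Real.sqrt_pos.2 ha) hx.1),
    Set.inter_eq_left.2 (show Set.Ioc (-(π / 2)) (π / 2) ⊆ Set.Ioo (-π) π from
      fun x hx => ⟨by linarith [hx.1, pi_pos], by linarith [hx.2, pi_pos]⟩)]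
  have hsa : 0 < √a := Real.sqrt_pos.2 ha
  have hsab : √a ≤ √b := Real.sqrt_le_sqrt hab
  rw [← integral_cos_pow_even_eq_Gamma, mul_comm, ENNReal.ofReal_mul,
    setLIntegral_congr (Ioc_ae_eq_Icc (a := √a) (b := √b)).symm]
  · congr 1
    · rw [← ofReal_integral_eq_lintegral_ofReal,
        intervalIntegral.integral_of_le (by linarith [pi_pos])]
      · exact (Continuous.integrableOn_Icc (by fun_prop)).mono_set Set.Ioc_subset_Icc_self
      · exact Filter.Eventually.of_forall fun x => by
          simp only [pow_mul, Pi.zero_apply]; positivity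
    · rw [← ofReal_integral_eq_lintegral_ofReal, ← intervalIntegral.integral_of_le hsab,
        integral_inv_of_pos hsa (by linarith)]
      · rw [Real.log_div, Real.log_sqrt ha.le, Real.log_sqrt (by linarith), Real.log_div]
        · congr 1; ring
        all_goals linarith
      · refine (ContinuousOn.integrableOn_Icc (continuousOn_inv₀.mono ?_)).mono_set
          Set.Ioc_subset_Icc_self
        intro x hx
        exact (lt_of_lt_of_le hsa hx.1).ne'
      · refine (ae_restrict_iff' measurableSet_Ioc).2 (Filter.Eventually.of_forall fun x hx => ?_)
        exact inv_nonneg.2 (hsa.trans hx.1).le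
  · refine intervalIntegral.integral_nonneg (by linarith [pi_pos]) fun x _ => ?_
    rw [pow_mul]; positivity

/-- The squared Euclidean norm of the horizontal part. -/
def hRadSq {n : ℕ} (ξ : Heis n) : ℝ := ∑ i, ((ξ.1 i) ^ 2 + (ξ.2.1 i) ^ 2)

/-- The fourth power of the homogeneous norm. -/
def hQuartic {n : ℕ} (ξ : Heis n) : ℝ := hRadSq ξ ^ 2 + ξ.2.2 ^ 2

theorem continuous_hRadSq {n : ℕ} : Continuous (hRadSq : Heis n → ℝ) :=
  continuous_finsetSum _ fun _ _ => by fun_prop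

theorem continuous_hQuartic {n : ℕ} : Continuous (hQuartic : Heis n → ℝ) :=
  (continuous_hRadSq.pow 2).add (by fun_prop)

theorem lintegral_heis_radial (n : ℕ) (hn : 1 ≤ n) {G : ℝ × ℝ → ℝ≥0∞} (hG : Measurable G) :
    ∫⁻ ξ : Heis n, G (hRadSq ξ, ξ.2.2) = ENNReal.ofReal (π ^ n / (n - 1).factorial) *
      ∫⁻ t : ℝ, ∫⁻ s in Set.Ioi (0 : ℝ), ENNReal.ofReal (s ^ (n - 1)) * G (s, t) := by
  have hq : Measurable fun z : (Fin n → ℝ) × (Fin n → ℝ) => ∑ i, (z.1 i ^ 2 + z.2 i ^ 2) :=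
    Finset.measurable_fun_sum _ fun _ _ => by fun_prop
  have hm : Measurable fun w : ((Fin n → ℝ) × (Fin n → ℝ)) × ℝ =>
      G (∑ i, (w.1.1 i ^ 2 + w.1.2 i ^ 2), w.2) :=
    hG.comp ((hq.comp measurable_fst).prodMk measurable_snd)
  have hm' : Measurable fun p : ℝ × ℝ => ENNReal.ofReal (p.2 ^ (n - 1)) * G (p.2, p.1) :=
    Measurable.mul (by fun_prop) (hG.comp measurable_swap)
  have h1 := (volume_preserving_prodAssoc (α₁ := Fin n → ℝ) (β₁ := Fin n → ℝ)
    (γ₁ := ℝ)).lintegral_comp_emb MeasurableEquiv.prodAssoc.measurableEmbedding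
    (fun ξ : Heis n => G (hRadSq ξ, ξ.2.2))
  rw [← h1]
  have h2 := lintegral_prod_symm (μ := (volume : Measure ((Fin n → ℝ) × (Fin n → ℝ))))
    (ν := (volume : Measure ℝ)) _ hm.aemeasurable
  refine h2.trans ?_
  rw [← lintegral_const_mul _ hm'.lintegral_prod_right']
  refine lintegral_congr fun t => ?_
  exact lintegral_sq_norm_prod n hn (f := fun s => G (s, t))
    (hG.comp (measurable_id.prodMk measurable_const))

theorem lintegral_heis_annulus (n : ℕ) (hn : 1 ≤ n) {a b : ℝ} (ha : 0 < a) (hab : a ≤ b) :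
    ∫⁻ ξ : Heis n, (if a ≤ hQuartic ξ ∧ hQuartic ξ ≤ b then
      ENNReal.ofReal ((hRadSq ξ / hQuartic ξ) ^ (n + 1)) else 0) =
    ENNReal.ofReal (sigmaQ n / 4 * Real.log (b / a)) := by
  have hGm : Measurable (fun p : ℝ × ℝ => if a ≤ p.1 ^ 2 + p.2 ^ 2 ∧ p.1 ^ 2 + p.2 ^ 2 ≤ b then
      ENNReal.ofReal ((p.1 / (p.1 ^ 2 + p.2 ^ 2)) ^ (n + 1)) else 0) := by
    have hN : Measurable fun p : ℝ × ℝ => p.1 ^ 2 + p.2 ^ 2 := by fun_prop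
    refine Measurable.ite ?_ (by fun_prop) measurable_const
    exact (measurableSet_le measurable_const hN).inter (measurableSet_le hN measurable_const)
  refine (lintegral_heis_radial n hn hGm).trans ?_
  rw [lintegral_polar_annulus n hn ha hab, ← ENNReal.ofReal_mul (by positivity)]
  congr 1
  simp only [sigmaQ, omegaSphere]
  ring

theorem exists_logarithmic_cutoff (μ ℓ : ℝ) (hℓ : 0 ≤ ℓ) :
    ∃ φ g : ℝ → ℝ, ContDiff ℝ (⊤ : ℕ∞) φ ∧ (∀ v, HasDerivAt φ (-(g v / v)) v) ∧
      (∀ v, 0 ≤ g v ∧ g v ≤ 1) ∧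
      (∀ v, ¬(exp (-μ - ℓ - 1) ≤ v ∧ v ≤ exp (-μ + 1)) → g v = 0) ∧
      (∀ v, 0 ≤ φ v ∧ φ v ≤ ℓ + 2) ∧ (∀ v, exp (-μ + 1) ≤ v → φ v = 0) ∧
      (∀ v, v ≤ exp (-μ - ℓ - 1) → ℓ ≤ φ v) := by
  set a := exp (-μ - ℓ - 1) with ha
  set a' := exp (-μ - ℓ) with ha'
  set b' := exp (-μ) with hb'
  set b := exp (-μ + 1) with hb
  have ha0 : 0 < a := exp_pos _
  have haa : a < a' := exp_lt_exp.2 (by linarith)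
  have hab : a' ≤ b' := exp_le_exp.2 (by linarith)
  have hbb : b' < b := exp_lt_exp.2 (by linarith)
  set g : ℝ → ℝ := fun v => Real.smoothTransition ((v - a) / (a' - a)) *
    Real.smoothTransition ((b - v) / (b - b')) with hg
  have hgs : ContDiff ℝ (⊤ : ℕ∞) g :=
    (Real.smoothTransition.contDiff.comp (by fun_prop)).mul
      (Real.smoothTransition.contDiff.comp (by fun_prop))
  have hg0 : ∀ v, 0 ≤ g v := fun v =>
    mul_nonneg (Real.smoothTransition.nonneg _) (Real.smoothTransition.nonneg _)
  have hg1 : ∀ v, g v ≤ 1 := fun v =>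
    mul_le_one₀ (Real.smoothTransition.le_one _) (Real.smoothTransition.nonneg _)
      (Real.smoothTransition.le_one _)
  have hga : ∀ v, v ≤ a → g v = 0 := fun v hv => by
    simp only [hg]
    rw [Real.smoothTransition.zero_of_nonpos, zero_mul]
    exact div_nonpos_of_nonpos_of_nonneg (by linarith) (by linarith)
  have hgb : ∀ v, b ≤ v → g v = 0 := fun v hv => by
    simp only [hg]
    rw [Real.smoothTransition.zero_of_nonpos (x := (b - v) / (b - b')), mul_zero]
    exact div_nonpos_of_nonpos_of_nonneg (by linarith) (by linarith)
  have hgone : ∀ v, a' ≤ v → v ≤ b' → g v = 1 := fun v h1 h2 => by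
    simp only [hg]
    rw [Real.smoothTransition.one_of_one_le, Real.smoothTransition.one_of_one_le, one_mul]
    · rw [one_le_div (by linarith)]; linarith
    · rw [one_le_div (by linarith)]; linarith
  set h : ℝ → ℝ := fun v => g v / v with hh
  have hhs : ContDiff ℝ (⊤ : ℕ∞) h := by
    rw [contDiff_iff_contDiffAt]
    intro v
    by_cases hv : v < a
    · refine (contDiffAt_const (c := (0 : ℝ))).congr_of_eventuallyEq ?_
      filter_upwards [Iio_mem_nhds hv] with w hw
      simp [hh, hga w (le_of_lt hw)]
    · exact hgs.contDiffAt.div contDiffAt_id (ha0.trans_le (not_lt.1 hv)).ne'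
  have hh0 : ∀ v, 0 ≤ h v := fun v => by
    rcases le_total v a with hv | hv
    · simp [hh, hga v hv]
    · exact div_nonneg (hg0 v) (by linarith)
  have hh_int : ∀ p q, IntervalIntegrable h volume p q :=
    fun p q => hhs.continuous.intervalIntegrable p q
  set φ : ℝ → ℝ := fun v => -∫ w in b..v, h w with hφ
  have hφd : ∀ v, HasDerivAt φ (-(h v)) v := fun v =>
    (intervalIntegral.integral_hasDerivAt_right (hh_int _ _)
      (hhs.continuous.stronglyMeasurableAtFilter _ _) hhs.continuous.continuousAt).neg
  have hφs : ContDiff ℝ (⊤ : ℕ∞) φ := by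
    rw [contDiff_infty_iff_deriv]
    refine ⟨fun v => (hφd v).differentiableAt, ?_⟩
    rw [show deriv φ = fun v => -(h v) from funext fun v => (hφd v).deriv]
    exact hhs.neg
  have hanti : Antitone φ := antitone_of_deriv_nonpos (fun v => (hφd v).differentiableAt)
    fun v => by rw [(hφd v).deriv]; linarith [hh0 v]
  have hφb : ∀ v, b ≤ v → φ v = 0 := fun v hv => by
    simp only [hφ]
    rw [intervalIntegral.integral_congr (g := fun _ => 0), intervalIntegral.integral_zero,
      neg_zero]
    intro w hw
    rw [Set.uIcc_of_le hv] at hw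
    simp [hh, hgb w hw.1]
  have hφa : ∀ v, v ≤ a → φ v = ∫ w in a..b, h w := fun v hv => by
    simp only [hφ]
    rw [← intervalIntegral.integral_symm, ← intervalIntegral.integral_add_adjacent_intervals
      (hh_int v a) (hh_int a b), intervalIntegral.integral_congr (g := fun _ => 0) (b := a),
      intervalIntegral.integral_zero, zero_add]
    intro w hw
    rw [Set.uIcc_of_le hv] at hw
    simp [hh, hga w hw.2]
  have hinv : ∀ p q, 0 < p → p ≤ q → IntervalIntegrable (fun w : ℝ => w⁻¹) volume p q :=
    fun p q hp hpq => by
      refine ContinuousOn.intervalIntegrable (continuousOn_inv₀.mono fun w hw => ?_)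
      rw [Set.uIcc_of_le hpq] at hw
      exact (lt_of_lt_of_le hp hw.1).ne'
  refine ⟨φ, g, hφs, hφd, fun v => ⟨hg0 v, hg1 v⟩, fun v hv => ?_, fun v => ⟨?_, ?_⟩, hφb,
    fun v hv => ?_⟩
  · rw [not_and_or, not_le, not_le] at hv
    exact hv.elim (fun h => hga v h.le) fun h => hgb v h.le
  · calc 0 = φ (max v b) := (hφb _ (le_max_right _ _)).symm
      _ ≤ φ v := hanti (le_max_left _ _)
  · calc φ v ≤ φ (min v a) := hanti (min_le_left _ _)
      _ = ∫ w in a..b, h w := hφa _ (min_le_right _ _)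
      _ ≤ ∫ w in a..b, w⁻¹ := by
        refine intervalIntegral.integral_mono_on (by linarith) (hh_int _ _)
          (hinv a b ha0 (by linarith)) fun w hw => ?_
        rw [← one_div]
        exact div_le_div_of_nonneg_right (hg1 w) (by linarith [hw.1])
      _ = ℓ + 2 := by
        rw [integral_inv_of_pos ha0 (by linarith), Real.log_div (by positivity) (by positivity),
          hb, ha, Real.log_exp, Real.log_exp]
        ring
  · rw [hφa v hv]
    calc ℓ = ∫ w in a'..b', w⁻¹ := by
          rw [integral_inv_of_pos (by linarith) (by linarith),
            Real.log_div (by positivity) (by positivity), hb', ha', Real.log_exp, Real.log_exp]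
          ring
      _ = ∫ w in a'..b', h w := by
        refine intervalIntegral.integral_congr fun w hw => ?_
        rw [Set.uIcc_of_le hab] at hw
        simp [hh, hgone w hw.1 hw.2]
      _ ≤ ∫ w in a..b, h w :=
        intervalIntegral.integral_mono_interval haa.le hab hbb.le
          (Filter.Eventually.of_forall hh0) (hh_int _ _)

theorem hasFDerivAt_hRadSq {n : ℕ} (ξ : Heis n) :
    HasFDerivAt (hRadSq : Heis n → ℝ) (∑ i, ((2 * ξ.1 i) • ((ContinuousLinearMap.proj i).comp
      (ContinuousLinearMap.fst ℝ (Fin n → ℝ) ((Fin n → ℝ) × ℝ))) +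
      (2 * ξ.2.1 i) • ((ContinuousLinearMap.proj i).comp ((ContinuousLinearMap.fst ℝ _ _).comp
      (ContinuousLinearMap.snd ℝ (Fin n → ℝ) ((Fin n → ℝ) × ℝ)))))) ξ := by
  refine HasFDerivAt.fun_sum fun i _ => ?_
  have h1 := ((ContinuousLinearMap.proj (R := ℝ) (φ := fun _ : Fin n => ℝ) i).comp
    (ContinuousLinearMap.fst ℝ (Fin n → ℝ) ((Fin n → ℝ) × ℝ))).hasFDerivAt (x := ξ)
  have h2 := ((ContinuousLinearMap.proj (R := ℝ) (φ := fun _ : Fin n => ℝ) i).comp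
    ((ContinuousLinearMap.fst ℝ _ _).comp
      (ContinuousLinearMap.snd ℝ (Fin n → ℝ) ((Fin n → ℝ) × ℝ)))).hasFDerivAt (x := ξ)
  convert (h1.pow 2).add (h2.pow 2) using 2 <;> simp

theorem contDiff_hQuartic {n : ℕ} : ContDiff ℝ (⊤ : ℕ∞) (hQuartic : Heis n → ℝ) := by
  have : ContDiff ℝ (⊤ : ℕ∞) (hRadSq : Heis n → ℝ) := ContDiff.sum fun i _ => by fun_prop
  exact (this.pow 2).add (by fun_prop)

theorem fderiv_hQuartic {n : ℕ} (ξ w : Heis n) :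
    fderiv ℝ hQuartic ξ w = 4 * hRadSq ξ * (∑ i, (ξ.1 i * w.1 i + ξ.2.1 i * w.2.1 i)) +
      2 * ξ.2.2 * w.2.2 := by
  have h2 := ((ContinuousLinearMap.snd ℝ _ _).comp
      (ContinuousLinearMap.snd ℝ (Fin n → ℝ) ((Fin n → ℝ) × ℝ))).hasFDerivAt (x := ξ)
  have h : HasFDerivAt hQuartic _ ξ := ((hasFDerivAt_hRadSq ξ).pow 2).add (h2.pow 2)
  rw [h.fderiv]
  simp [mul_assoc, ← mul_add, ← Finset.mul_sum]
  ring

theorem hGradNorm_comp_hQuartic {n : ℕ} {f : ℝ → ℝ} {f' : ℝ} (ξ : Heis n)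
    (hf : HasDerivAt f f' (hQuartic ξ)) :
    hGradNorm (fun η => f (hQuartic η)) ξ = √(16 * f' ^ 2 * hQuartic ξ * hRadSq ξ) := by
  have hd : ∀ w, fderiv ℝ (fun η => f (hQuartic η)) ξ w = f' * fderiv ℝ hQuartic ξ w := by
    intro w
    have h := hf.comp_hasFDerivAt ξ
      ((contDiff_hQuartic.differentiable (by simp)).differentiableAt (x := ξ)).hasFDerivAt
    have h' : HasFDerivAt (fun η => f (hQuartic η)) (f' • fderiv ℝ hQuartic ξ) ξ := h
    rw [h'.fderiv]
    simp
  have hx : ∀ i, Xd (fun η => f (hQuartic η)) i ξ =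
      f' * (4 * (hRadSq ξ * ξ.1 i + ξ.2.2 * ξ.2.1 i)) := fun i => by
    simp [Xd, hd, fderiv_hQuartic, Pi.single_apply]
    ring
  have hy : ∀ i, Yd (fun η => f (hQuartic η)) i ξ =
      f' * (4 * (hRadSq ξ * ξ.2.1 i - ξ.2.2 * ξ.1 i)) := fun i => by
    simp [Yd, hd, fderiv_hQuartic, Pi.single_apply]
    ring
  rw [hGradNorm]
  congr 1
  calc ∑ i, ((Xd (fun η => f (hQuartic η)) i ξ) ^ 2 + (Yd (fun η => f (hQuartic η)) i ξ) ^ 2)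
      = ∑ i, 16 * f' ^ 2 * hQuartic ξ * (ξ.1 i ^ 2 + ξ.2.1 i ^ 2) :=
        Finset.sum_congr rfl fun i _ => by rw [hx, hy, hQuartic]; ring
    _ = _ := by rw [← Finset.mul_sum, hRadSq]

theorem hRadSq_nonneg {n : ℕ} (ξ : Heis n) : 0 ≤ hRadSq ξ :=
  Finset.sum_nonneg fun _ _ => by positivity

theorem hQuartic_nonneg {n : ℕ} (ξ : Heis n) : 0 ≤ hQuartic ξ := by
  unfold hQuartic; positivity

theorem norm_fst_le_one {n : ℕ} {ξ : Heis n} (h : hQuartic ξ ≤ 1) :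
    ‖ξ.1‖ ≤ 1 ∧ ‖ξ.2.1‖ ≤ 1 := by
  have hs : hRadSq ξ ≤ 1 := by
    have := hRadSq_nonneg ξ
    unfold hQuartic at h
    nlinarith [sq_nonneg ξ.2.2]
  have hi : ∀ i, ξ.1 i ^ 2 + ξ.2.1 i ^ 2 ≤ 1 := fun i =>
    (Finset.single_le_sum (f := fun i => ξ.1 i ^ 2 + ξ.2.1 i ^ 2)
      (fun _ _ => by positivity) (Finset.mem_univ i)).trans hs
  constructor
  · refine (pi_norm_le_iff_of_nonneg zero_le_one).2 fun i => ?_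
    rw [Real.norm_eq_abs, ← sq_le_one_iff_abs_le_one]
    nlinarith [hi i, sq_nonneg (ξ.2.1 i)]
  · refine (pi_norm_le_iff_of_nonneg zero_le_one).2 fun i => ?_
    rw [Real.norm_eq_abs, ← sq_le_one_iff_abs_le_one]
    nlinarith [hi i, sq_nonneg (ξ.1 i)]

theorem abs_snd_le_sqrt_hQuartic {n : ℕ} (ξ : Heis n) : |ξ.2.2| ≤ √(hQuartic ξ) :=
  Real.abs_le_sqrt (by unfold hQuartic; nlinarith [sq_nonneg (hRadSq ξ)])

theorem volume_closedBall_prod (n : ℕ) {r : ℝ} (hr : 0 ≤ r) (s : Set ℝ) :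
    volume (Metric.closedBall (0 : Fin n → ℝ) r ×ˢ
      (Metric.closedBall (0 : Fin n → ℝ) r ×ˢ s)) =
      ENNReal.ofReal ((2 * r) ^ (2 * n)) * volume s := by
  rw [Measure.volume_eq_prod, Measure.prod_prod, Measure.volume_eq_prod, Measure.prod_prod,
    Real.volume_pi_closedBall _ hr, Fintype.card_fin, ← mul_assoc,
    ← ENNReal.ofReal_mul (by positivity), two_mul n, pow_add]

theorem hQuartic_le_of_mem_box {n : ℕ} {r : ℝ} {ξ : Heis n} (hx : ‖ξ.1‖ ≤ r)
    (hy : ‖ξ.2.1‖ ≤ r) (ht : |ξ.2.2| ≤ r ^ 2) : hQuartic ξ ≤ (4 * n ^ 2 + 1) * r ^ 4 := by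
  have hs : hRadSq ξ ≤ 2 * n * r ^ 2 := by
    calc hRadSq ξ ≤ ∑ _i : Fin n, 2 * r ^ 2 := Finset.sum_le_sum fun i _ => by
          have h1 := sq_le_sq' (abs_le.1 ((norm_le_pi_norm ξ.1 i).trans hx)).1
            (abs_le.1 ((norm_le_pi_norm ξ.1 i).trans hx)).2
          have h2 := sq_le_sq' (abs_le.1 ((norm_le_pi_norm ξ.2.1 i).trans hy)).1
            (abs_le.1 ((norm_le_pi_norm ξ.2.1 i).trans hy)).2
          linarith
      _ = 2 * n * r ^ 2 := by simp; ring
  have h1 := pow_le_pow_left₀ (hRadSq_nonneg ξ) hs 2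
  have h2 := sq_le_sq' (abs_le.1 ht).1 (abs_le.1 ht).2
  unfold hQuartic
  nlinarith

open Filter Topology in
theorem exists_exp_half_le_zeta (Q : ℕ) : ∃ s₀ : ℝ, ∀ s, s₀ ≤ s → exp s / 2 ≤ zeta Q s := by
  have h : Tendsto (fun s : ℝ => ∑ k ∈ Finset.range (Q - 1), s ^ k / (Nat.factorial k) * exp (-s))
      atTop (𝓝 0) := by
    rw [show (0 : ℝ) = ∑ k ∈ Finset.range (Q - 1), 0 by simp]
    refine tendsto_finsetSum _ fun k _ => ?_
    simpa [div_mul_eq_mul_div] using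
      (tendsto_pow_mul_exp_neg_atTop_nhds_zero k).div_const (Nat.factorial k : ℝ)
  obtain ⟨s₀, hs₀⟩ := eventually_atTop.1 (h.eventually_le_const (u := 1 / 2) (by norm_num))
  refine ⟨s₀, fun s hs => ?_⟩
  have h1 := hs₀ s hs
  rw [← Finset.sum_mul, exp_neg, ← div_eq_mul_inv, div_le_iff₀ (exp_pos s)] at h1
  unfold zeta
  linarith

open Filter Topology in
theorem tendsto_moser_exponent {p D : ℝ} (hp : 0 < p) (hD : 0 < D) :
    Tendsto (fun ℓ : ℝ => ((D * (ℓ + 2) + 1) ^ (-(1 / (p + 1))) * ℓ) ^ ((p + 1) / p) / ℓ) atTop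
      (𝓝 ((1 / D) ^ (1 / p))) := by
  have h1 : Tendsto (fun ℓ : ℝ => ℓ / (D * (ℓ + 2) + 1)) atTop (𝓝 (1 / D)) := by
    have h2 : Tendsto (fun ℓ : ℝ => 1 / (D + (2 * D + 1) * ℓ⁻¹)) atTop
        (𝓝 (1 / (D + (2 * D + 1) * 0))) :=
      tendsto_const_nhds.div (tendsto_const_nhds.add (tendsto_inv_atTop_zero.const_mul _))
        (by simpa using hD.ne')
    rw [mul_zero, add_zero] at h2
    refine h2.congr' ?_
    filter_upwards [eventually_gt_atTop 0] with ℓ hℓ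
    field_simp
    ring
  refine (h1.rpow_const (p := 1 / p) (Or.inr (by positivity))).congr' ?_
  filter_upwards [eventually_gt_atTop 0] with ℓ hℓ
  have hW : 0 < D * (ℓ + 2) + 1 := by positivity
  rw [Real.mul_rpow (by positivity) hℓ.le, ← Real.rpow_mul hW.le,
    Real.div_rpow hℓ.le hW.le, show (p + 1) / p = 1 / p + 1 by field_simp; ring, Real.rpow_add hℓ,
    Real.rpow_one, show -(1 / (p + 1)) * (1 / p + 1) = -(1 / p) by field_simp; ring, Real.rpow_neg hW.le]
  field_simp

open Filter Topology in
theorem exists_moser_parameters (Q : ℕ) {p σ α β τ K c C s₀ : ℝ} (hp : 0 < p) (hσ : 0 < σ)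
    (hβ : β < p + 1) (hα : (p + 1 - β) * σ ^ (1 / p) < α) (hc : 0 < c) :
    ∃ ε ℓ : ℝ, 0 < ε ∧ 0 ≤ ℓ ∧ τ * (ℓ + 2) ^ Q * (K * √(exp (-(ε * ℓ + 1) + 1))) ≤ 1 ∧
      s₀ ≤ α * ((4 ^ p * σ * (ℓ + 2) + 1) ^ (-(1 / (p + 1))) * ℓ) ^ ((p + 1) / p) ∧
      C < c * exp (-(ε * ℓ + 1) - ℓ - 1) ^ ((p + 1 - β) / 4) *
        exp (α * ((4 ^ p * σ * (ℓ + 2) + 1) ^ (-(1 / (p + 1))) * ℓ) ^ ((p + 1) / p)) := by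
  set D : ℝ := 4 ^ p * σ with hDdef
  have hD : 0 < D := by positivity
  set q := (p + 1 - β) / 4 with hq
  have hq0 : 0 < q := by rw [hq]; linarith
  set κ := α * (1 / D) ^ (1 / p) with hκ
  have hκq : q < κ := by
    have h4 : (1 / D) ^ (1 / p) = 1 / (4 * σ ^ (1 / p)) := by
      rw [Real.div_rpow zero_le_one hD.le, Real.one_rpow, hDdef,
        Real.mul_rpow (by positivity) hσ.le, ← Real.rpow_mul (by norm_num), mul_one_div_cancel hp.ne',
        Real.rpow_one]
    have hσp : 0 < σ ^ (1 / p) := by positivity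
    rw [hκ, h4, hq, mul_one_div, lt_div_iff₀ (by positivity)]
    linarith
  set ε := (κ - q) / (2 * (q + 1)) with hε
  have hε0 : 0 < ε := div_pos (by linarith) (by linarith)
  have hεκ : q * (1 + ε) + ε < κ := by
    have : ε * (q + 1) = (κ - q) / 2 := by rw [hε]; field_simp
    nlinarith
  set s : ℝ → ℝ := fun ℓ => α * ((D * (ℓ + 2) + 1) ^ (-(1 / (p + 1))) * ℓ) ^ ((p + 1) / p) with hs
  have hslim : Tendsto (fun ℓ => s ℓ / ℓ) atTop (𝓝 κ) := by
    simp only [hs, mul_div_assoc]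
    exact (tendsto_moser_exponent hp hD).const_mul α
  have hsge : ∀ᶠ ℓ in atTop, (q * (1 + ε) + ε) * ℓ ≤ s ℓ := by
    filter_upwards [hslim.eventually_const_le hεκ, eventually_gt_atTop 0] with ℓ h1 h2
    rwa [le_div_iff₀ h2] at h1
  have hsmall : Tendsto (fun ℓ : ℝ => τ * (ℓ + 2) ^ Q * (K * √(exp (-(ε * ℓ + 1) + 1)))) atTop
      (𝓝 0) := by
    have h1 := ((tendsto_rpow_mul_exp_neg_mul_atTop_nhds_zero Q (ε / 2) (by positivity)).comp
      (tendsto_atTop_add_const_right atTop (2 : ℝ) tendsto_id)).const_mul (τ * K * exp ε)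
    rw [mul_zero] at h1
    refine h1.congr fun ℓ => ?_
    simp only [Function.comp, id, Real.rpow_natCast]
    rw [Real.sqrt_eq_rpow, ← Real.exp_mul, mul_comm ((ℓ + 2) ^ Q), ← mul_assoc, mul_assoc (τ * K),
      ← Real.exp_add, show ε + -(ε / 2) * (ℓ + 2) = (-(ε * ℓ + 1) + 1) * (1 / 2) by ring]
    ring
  have hbig : Tendsto (fun ℓ : ℝ => c * exp (ε * ℓ - 2 * q)) atTop atTop := by
    refine Tendsto.const_mul_atTop hc (Real.tendsto_exp_atTop.comp ?_)
    exact tendsto_atTop_add_const_right _ _ (tendsto_id.const_mul_atTop hε0)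
  have hlin : Tendsto (fun ℓ : ℝ => (q * (1 + ε) + ε) * ℓ) atTop atTop :=
    tendsto_id.const_mul_atTop (by positivity)
  obtain ⟨ℓ, h0, h1, h2, h3, h4⟩ := ((eventually_ge_atTop (0 : ℝ)).and
    ((hsmall.eventually_le_const zero_lt_one).and (hsge.and ((hlin.eventually_ge_atTop s₀).and
      (hbig.eventually_gt_atTop C))))).exists
  refine ⟨ε, ℓ, hε0, h0, h1, h3.trans h2, h4.trans_le ?_⟩
  rw [← Real.exp_mul, mul_assoc, ← Real.exp_add]
  refine mul_le_mul_of_nonneg_left (Real.exp_le_exp.2 ?_) hc.le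
  simp only [hs] at h2
  linarith

theorem lintegral_energy_le {n : ℕ} (hn : 1 ≤ n) {τ a b B M : ℝ} {φ g : ℝ → ℝ} (hτ : 0 ≤ τ)
    (hB : 0 ≤ B) (hM : 0 ≤ M) (ha : 0 < a) (hab : a ≤ b) (hb : b ≤ 1)
    (hφ : ∀ v, HasDerivAt φ (-(g v / v)) v) (hg : ∀ v, 0 ≤ g v ∧ g v ≤ 1)
    (hgsupp : ∀ v, ¬(a ≤ v ∧ v ≤ b) → g v = 0) (hφM : ∀ v, 0 ≤ φ v ∧ φ v ≤ M)
    (hφb : ∀ v, b ≤ v → φ v = 0) :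
    ∫⁻ ξ : Heis n, ENNReal.ofReal (hGradNorm (fun η => B * φ (hQuartic η)) ξ ^ (2 * n + 2) +
      τ * |B * φ (hQuartic ξ)| ^ (2 * n + 2)) ≤
    ENNReal.ofReal ((16 * B ^ 2) ^ (n + 1) * (sigmaQ n / 4 * Real.log (b / a)) +
      τ * (B * M) ^ (2 * n + 2) * (2 ^ (2 * n) * (2 * √b))) := by
  set T : Set (Heis n) := Metric.closedBall 0 1 ×ˢ (Metric.closedBall 0 1 ×ˢ Set.Icc (-√b) (√b))
    with hT
  have hTm : MeasurableSet T := (Metric.isClosed_closedBall.prod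
    (Metric.isClosed_closedBall.prod isClosed_Icc)).measurableSet
  have hσ : 0 ≤ sigmaQ n := by
    have := Real.Gamma_nonneg_of_nonneg (s := 1 / 2) (by norm_num)
    have := Real.Gamma_nonneg_of_nonneg (s := n + 1 / 2) (by positivity)
    unfold sigmaQ omegaSphere
    positivity
  have hlog : 0 ≤ Real.log (b / a) := Real.log_nonneg ((one_le_div ha).2 hab)
  have hpt : ∀ ξ : Heis n, ENNReal.ofReal (hGradNorm (fun η => B * φ (hQuartic η)) ξ ^ (2 * n + 2) +
      τ * |B * φ (hQuartic ξ)| ^ (2 * n + 2)) ≤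
      ENNReal.ofReal ((16 * B ^ 2) ^ (n + 1)) * (if a ≤ hQuartic ξ ∧ hQuartic ξ ≤ b then
        ENNReal.ofReal ((hRadSq ξ / hQuartic ξ) ^ (n + 1)) else 0) +
      T.indicator (fun _ => ENNReal.ofReal (τ * (B * M) ^ (2 * n + 2))) ξ := by
    intro ξ
    have hN := hQuartic_nonneg ξ
    have hS := hRadSq_nonneg ξ
    rw [hGradNorm_comp_hQuartic ξ ((hφ _).const_mul B), ENNReal.ofReal_add (by positivity)
      (by positivity), show 2 * n + 2 = 2 * (n + 1) by ring, pow_mul √_, Real.sq_sqrt (by positivity)]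
    refine add_le_add ?_ ?_
    · split_ifs with h
      · rw [← ENNReal.ofReal_mul (by positivity), ← mul_pow]
        have hN0 : 0 < hQuartic ξ := ha.trans_le h.1
        refine ENNReal.ofReal_le_ofReal (pow_le_pow_left₀ (by positivity) ?_ _)
        calc 16 * (B * -(g (hQuartic ξ) / hQuartic ξ)) ^ 2 * hQuartic ξ * hRadSq ξ
            = g (hQuartic ξ) ^ 2 * (16 * B ^ 2 * (hRadSq ξ / hQuartic ξ)) := by
              field_simp
          _ ≤ 1 * (16 * B ^ 2 * (hRadSq ξ / hQuartic ξ)) :=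
              mul_le_mul_of_nonneg_right (pow_le_one₀ (hg _).1 (hg _).2) (by positivity)
          _ = _ := one_mul _
      · simp [hgsupp _ h]
    · by_cases h : hQuartic ξ ≤ b
      · have hmem : ξ ∈ T := by
          have h1 := norm_fst_le_one (h.trans hb)
          refine ⟨by simpa using h1.1, by simpa using h1.2, ?_⟩
          exact abs_le.1 ((abs_snd_le_sqrt_hQuartic ξ).trans (Real.sqrt_le_sqrt h))
        rw [Set.indicator_of_mem hmem]
        refine ENNReal.ofReal_le_ofReal (mul_le_mul_of_nonneg_left
          (pow_le_pow_left₀ (abs_nonneg _) ?_ _) hτ)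
        rw [abs_of_nonneg (mul_nonneg hB (hφM _).1)]
        exact mul_le_mul_of_nonneg_left (hφM _).2 hB
      · rw [hφb _ (not_le.1 h).le]
        simp
  refine (lintegral_mono hpt).trans ?_
  rw [lintegral_add_right _ (measurable_const.indicator hTm),
    lintegral_const_mul' _ _ ENNReal.ofReal_ne_top, lintegral_heis_annulus n hn ha hab,
    lintegral_indicator_const hTm, hT, volume_closedBall_prod n zero_le_one, Real.volume_Icc,
    ← ENNReal.ofReal_mul (by positivity), ← ENNReal.ofReal_mul (by positivity),
    ← ENNReal.ofReal_mul (by positivity), ← ENNReal.ofReal_add (by positivity)]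
  · refine ENNReal.ofReal_le_ofReal (le_of_eq ?_)
    ring
  · have : 0 ≤ √b - -√b := by linarith [Real.sqrt_nonneg b]
    positivity

theorem le_lintegral_singular_functional {n : ℕ} {α β a v : ℝ} {u : Heis n → ℝ} (ha : 0 < a)
    (hβ : 0 ≤ β) (hα : 0 ≤ α) (hv : 0 ≤ v) (hu : ∀ ξ, hQuartic ξ ≤ a → v ≤ |u ξ|)
    (hz : ∀ s, α * v ^ ((2 * (n : ℝ) + 2) / (2 * n + 1)) ≤ s → exp s / 2 ≤ zeta (2 * n + 2) s) :
    ENNReal.ofReal (2 ^ (2 * n) * (1 / (4 * (n : ℝ) ^ 2 + 1)) ^ (((n : ℝ) + 1) / 2) / 2 *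
      a ^ ((2 * n + 1 + 1 - β) / 4) * exp (α * v ^ ((2 * (n : ℝ) + 2) / (2 * n + 1)))) ≤
    ∫⁻ ξ : Heis n, ENNReal.ofReal ((hNorm ξ) ^ (-β) *
      zeta (2 * n + 2) (α * |u ξ| ^ ((2 * (n : ℝ) + 2) / (2 * n + 1)))) := by
  set k : ℝ := 4 * (n : ℝ) ^ 2 + 1 with hk
  have hk0 : 0 < k := by positivity
  set r : ℝ := (a / k) ^ ((1 : ℝ) / 4) with hr
  have hr0 : 0 < r := by positivity
  have hr4 : k * r ^ 4 = a := by
    rw [hr, ← Real.rpow_natCast, ← Real.rpow_mul (by positivity)]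
    norm_num
    field_simp
  set s := α * v ^ ((2 * (n : ℝ) + 2) / (2 * n + 1)) with hs
  set T : Set (Heis n) := Metric.closedBall 0 r ×ˢ (Metric.closedBall 0 r ×ˢ Set.Ioc 0 (r ^ 2))
    with hT
  have hTm : MeasurableSet T := Metric.isClosed_closedBall.measurableSet.prod
    (Metric.isClosed_closedBall.measurableSet.prod measurableSet_Ioc)
  have hpt : ∀ ξ : Heis n, T.indicator
      (fun _ => ENNReal.ofReal ((a ^ ((1 : ℝ) / 4)) ^ (-β) * (exp s / 2))) ξ ≤
      ENNReal.ofReal ((hNorm ξ) ^ (-β) *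
        zeta (2 * n + 2) (α * |u ξ| ^ ((2 * (n : ℝ) + 2) / (2 * n + 1)))) := by
    intro ξ
    by_cases hξ : ξ ∈ T
    · obtain ⟨hx, hy, ht⟩ := hξ
      have hle : hQuartic ξ ≤ a := hr4 ▸ hQuartic_le_of_mem_box (by simpa using hx)
        (by simpa using hy) (by rw [abs_of_pos ht.1]; exact ht.2)
      have hpos : 0 < hQuartic ξ := add_pos_of_nonneg_of_pos (by positivity) (pow_pos ht.1 2)
      rw [Set.indicator_of_mem (show ξ ∈ T from ⟨hx, hy, ht⟩)]
      have hnorm : hNorm ξ = hQuartic ξ ^ ((1 : ℝ) / 4) := rfl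
      have hs' : s ≤ α * |u ξ| ^ ((2 * (n : ℝ) + 2) / (2 * n + 1)) :=
        mul_le_mul_of_nonneg_left (Real.rpow_le_rpow hv (hu ξ hle) (by positivity)) hα
      refine ENNReal.ofReal_le_ofReal (mul_le_mul ?_ ?_ (by positivity) ?_)
      · rw [hnorm]
        exact Real.rpow_le_rpow_of_nonpos (by positivity)
          (Real.rpow_le_rpow hpos.le hle (by norm_num)) (by linarith)
      · refine le_trans ?_ (hz _ hs')
        linarith [Real.exp_le_exp.2 hs']
      · rw [hnorm]; positivity
    · simp [Set.indicator_of_notMem hξ]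
  refine le_trans ?_ (lintegral_mono hpt)
  rw [lintegral_indicator_const hTm, hT, volume_closedBall_prod n hr0.le, Real.volume_Ioc,
    ← ENNReal.ofReal_mul (by positivity), ← ENNReal.ofReal_mul (by positivity)]
  refine ENNReal.ofReal_le_ofReal (le_of_eq ?_)
  have h1 : (a ^ ((1 : ℝ) / 4)) ^ (-β) = a ^ (-β / 4) := by
    rw [← Real.rpow_mul ha.le]; congr 1; ring
  have h2 : r ^ (2 * n + 2) = a ^ (((n : ℝ) + 1) / 2) * (1 / k) ^ (((n : ℝ) + 1) / 2) := by
    rw [← Real.mul_rpow ha.le (by positivity), mul_one_div, hr, ← Real.rpow_natCast,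
      ← Real.rpow_mul (by positivity)]
    congr 1
    push_cast
    ring
  have h3 : a ^ ((2 * n + 1 + 1 - β) / 4) = a ^ (-β / 4) * a ^ (((n : ℝ) + 1) / 2) := by
    rw [← Real.rpow_add ha]; congr 1; ring
  rw [h1, h3]
  calc _ = a ^ (-β / 4) * (exp s / 2) * 2 ^ (2 * n) *
        (a ^ (((n : ℝ) + 1) / 2) * (1 / k) ^ (((n : ℝ) + 1) / 2)) := by ring
    _ = _ := by rw [← h2]; ring

/-- Sharpness in Theorem 1.1: if `α > α_Q(1-β/Q)`, the supremum of the singular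
Trudinger–Moser functional over the unit ball of `‖·‖_{1,τ}` is infinite. -/
theorem trudinger_moser_heisenberg_sharp (n : ℕ) (hn : 1 ≤ n) (τ β α : ℝ)
    (hτ : 0 < τ) (hβ0 : 0 ≤ β) (hβ : β < 2 * n + 2)
    (hα : alphaQ n * (1 - β / (2 * n + 2)) < α) :
    ∀ C : ℝ, 0 < C → ∃ u : Heis n → ℝ, ContDiff ℝ (⊤ : ℕ∞) u ∧ HasCompactSupport u ∧
      (∫⁻ ξ, ENNReal.ofReal (hGradNorm u ξ ^ (2 * n + 2) + τ * |u ξ| ^ (2 * n + 2)) ≤ 1) ∧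
      ENNReal.ofReal C <
        ∫⁻ ξ, ENNReal.ofReal ((hNorm ξ) ^ (-β) *
          zeta (2 * n + 2) (α * |u ξ| ^ ((2 * (n : ℝ) + 2) / (2 * n + 1)))) := by
  intro C hC
  have hσ : 0 < sigmaQ n := by
    have := Real.Gamma_pos_of_pos (s := 1 / 2) (by norm_num)
    have := Real.Gamma_pos_of_pos (s := n + 1 / 2) (by positivity)
    unfold sigmaQ omegaSphere
    positivity
  have hα' : (2 * n + 1 + 1 - β) * sigmaQ n ^ ((1 : ℝ) / (2 * n + 1)) < α := by
    refine lt_of_eq_of_lt ?_ hα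
    rw [alphaQ]
    field_simp
    ring
  have hα0 : 0 < α := lt_trans (mul_pos (by linarith) (by positivity)) hα'
  obtain ⟨s₀, hs₀⟩ := exists_exp_half_le_zeta (2 * n + 2)
  obtain ⟨ε, ℓ, hε, hℓ, hsmall, hs, hbig⟩ := exists_moser_parameters (2 * n + 2) (τ := τ) (C := C)
    (K := 2 ^ (2 * n) * 2) (s₀ := s₀)
    (c := 2 ^ (2 * n) * (1 / (4 * (n : ℝ) ^ 2 + 1)) ^ (((n : ℝ) + 1) / 2) / 2)
    (by positivity : (0 : ℝ) < 2 * n + 1) hσ (by linarith) hα' (by positivity)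
  set W : ℝ := 4 ^ (2 * (n : ℝ) + 1) * sigmaQ n * (ℓ + 2) + 1 with hWdef
  have hW : 0 < W := by positivity
  set B : ℝ := W ^ (-((1 : ℝ) / (2 * n + 1 + 1))) with hBdef
  have hB : 0 < B := by positivity
  have hBW : B ^ (2 * n + 2) = W⁻¹ := by
    rw [hBdef, ← Real.rpow_natCast, ← Real.rpow_mul hW.le, ← Real.rpow_neg_one]
    congr 1
    push_cast
    field_simp
    ring
  rw [show (2 * (n : ℝ) + 1 + 1) / (2 * n + 1) = (2 * (n : ℝ) + 2) / (2 * n + 1) by ring] at hs hbig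
  obtain ⟨φ, g, hφs, hφd, hg, hgsupp, hφM, hφb, hφa⟩ := exists_logarithmic_cutoff (ε * ℓ + 1) ℓ hℓ
  have hb1 : exp (-(ε * ℓ + 1) + 1) ≤ 1 := by
    rw [Real.exp_le_one_iff]
    nlinarith
  refine ⟨fun ξ => B * φ (hQuartic ξ), contDiff_const.mul (hφs.comp contDiff_hQuartic), ?_, ?_, ?_⟩
  · refine HasCompactSupport.intro (isCompact_closedBall (0 : Heis n) 1) fun ξ hξ => ?_
    rw [hφb, mul_zero]
    by_contra! h
    have h1 := h.le.trans hb1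
    have h2 := norm_fst_le_one h1
    refine hξ (mem_closedBall_zero_iff.2 ?_)
    refine norm_prod_le_iff.2 ⟨h2.1, norm_prod_le_iff.2 ⟨h2.2, ?_⟩⟩
    exact (abs_snd_le_sqrt_hQuartic ξ).trans (Real.sqrt_le_one.2 h1)
  · refine (lintegral_energy_le hn hτ.le hB.le (by linarith) (exp_pos _)
      (exp_le_exp.2 (by linarith)) hb1 hφd hg hgsupp hφM hφb).trans ?_
    rw [← ENNReal.ofReal_one]
    refine ENNReal.ofReal_le_ofReal ?_
    rw [← Real.exp_sub, Real.log_exp, mul_pow, mul_pow, ← pow_mul, mul_add 2 n 1, mul_one, hBW]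
    have h16 : (16 : ℝ) ^ (n + 1) = 4 * 4 ^ (2 * (n : ℝ) + 1) := by
      rw [show (2 * (n : ℝ) + 1) = ((2 * n + 1 : ℕ) : ℝ) by push_cast; ring, Real.rpow_natCast,
        ← pow_succ', show 2 * n + 1 + 1 = 2 * (n + 1) by ring, pow_mul]
      norm_num
    rw [h16]
    calc _ = W⁻¹ * (4 ^ (2 * (n : ℝ) + 1) * sigmaQ n * (ℓ + 2) + τ * (ℓ + 2) ^ (2 * n + 2) *
          (2 ^ (2 * n) * 2 * √(exp (-(ε * ℓ + 1) + 1)))) := by ring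
      _ ≤ W⁻¹ * W := mul_le_mul_of_nonneg_left (by linarith) (by positivity)
      _ = 1 := inv_mul_cancel₀ hW.ne'
  · refine lt_of_lt_of_le ?_ (le_lintegral_singular_functional (a := exp (-(ε * ℓ + 1) - ℓ - 1))
      (v := B * ℓ) (exp_pos _) hβ0 hα0.le (by positivity) (fun ξ hξ => ?_)
      fun s h => hs₀ s (hs.trans h))
    · exact (ENNReal.ofReal_lt_ofReal_iff_of_nonneg hC.le).2 hbig
    · rw [abs_of_nonneg (mul_nonneg hB.le (hφM _).1)]
      exact mul_le_mul_of_nonneg_left (hφa _ hξ) hB.le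
end
end

section
/- Let n ≥ 1, Q = 2n+2, Q' = Q/(Q−1), 0 ≤ β < Q, and α > 0 arbitrary. If u : ℝ^{2n+1} → ℝ is smooth and satisfies ∫_{ℍ^n} (|∇_H u|^Q + |u|^Q) dξ < ∞, then ∫_{ℍ^n} |ξ|_h^{−β} ζ(Q, α|u|^{Q'}) dξ < ∞. -/
open MeasureTheory Real ENNReal

noncomputable section

open scoped NNReal

section HeisenbergGroup

variable {n : ℕ}

lemma hMul_assoc (a b c : Heis n) : hMul (hMul a b) c = hMul a (hMul b c) := by
  ext i
  · simp [hMul, add_assoc]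
  · simp [hMul, add_assoc]
  · simp only [hMul, Pi.add_apply, add_mul, mul_add, Finset.sum_add_distrib]
    ring

lemma hMul_zero (a : Heis n) : hMul a 0 = a := by
  ext i <;> simp [hMul]

lemma zero_hMul (a : Heis n) : hMul 0 a = a := by
  ext i <;> simp [hMul]

lemma neg_hMul_self (a : Heis n) : hMul (-a) a = 0 := by
  ext i
  · simp [hMul]
  · simp [hMul]
  · simp [hMul, mul_comm]

lemma hMul_neg_self (a : Heis n) : hMul a (-a) = 0 := by
  simpa using neg_hMul_self (-a)

lemma neg_hMul_cancel_left (a b : Heis n) : hMul (-a) (hMul a b) = b := by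
  rw [← hMul_assoc, neg_hMul_self, zero_hMul]

lemma hMul_neg_cancel_right (a b : Heis n) : hMul (hMul a b) (-b) = a := by
  rw [hMul_assoc, hMul_neg_self, hMul_zero]

lemma continuous_hMul : Continuous fun p : Heis n × Heis n => hMul p.1 p.2 := by
  unfold hMul
  fun_prop

lemma continuous_hMul_left (a : Heis n) : Continuous (hMul a) :=
  continuous_hMul.comp (by fun_prop : Continuous fun b : Heis n => (a, b))

lemma continuous_hMul_right (b : Heis n) : Continuous fun a : Heis n => hMul a b :=
  continuous_hMul.comp (by fun_prop : Continuous fun a : Heis n => (a, b))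

lemma measurePreserving_shear (a b : Fin n → ℝ) (c : (Fin n → ℝ) → (Fin n → ℝ) → ℝ)
    (hc : Continuous fun p : (Fin n → ℝ) × (Fin n → ℝ) => c p.1 p.2) :
    MeasurePreserving (fun ξ : Heis n => (ξ.1 + a, ξ.2.1 + b, ξ.2.2 + c ξ.1 ξ.2.1)) := by
  refine MeasurePreserving.skew_product
    (g := fun x (p : (Fin n → ℝ) × ℝ) => (p.1 + b, p.2 + c x p.1))
    (measurePreserving_add_right volume a) ?_ (Filter.Eventually.of_forall fun x => ?_)
  · apply Continuous.measurable
    have : Continuous fun q : (Fin n → ℝ) × (Fin n → ℝ) × ℝ => c q.1 q.2.1 :=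
      hc.comp (by fun_prop : Continuous fun q : (Fin n → ℝ) × (Fin n → ℝ) × ℝ => (q.1, q.2.1))
    simp only [Function.uncurry_def]
    fun_prop
  · refine (MeasurePreserving.skew_product
      (g := fun y (t : ℝ) => t + c x y)
      (measurePreserving_add_right volume b) ?_
      (Filter.Eventually.of_forall fun y =>
        (measurePreserving_add_right volume (c x y)).map_eq)).map_eq
    apply Continuous.measurable
    have : Continuous fun q : (Fin n → ℝ) × ℝ => c x q.1 :=
      hc.comp (by fun_prop : Continuous fun q : (Fin n → ℝ) × ℝ => (x, q.1))
    simp only [Function.uncurry_def]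
    fun_prop

lemma measurePreserving_hMul_left (a : Heis n) : MeasurePreserving (hMul a) := by
  convert measurePreserving_shear a.1 a.2.1
    (fun x y => a.2.2 + 2 * ((∑ i, a.2.1 i * x i) - ∑ i, a.1 i * y i)) (by fun_prop) using 2 with ξ
  simp only [hMul, Prod.mk.injEq]
  exact ⟨add_comm _ _, add_comm _ _, by ring⟩

lemma measurePreserving_hMul_right (b : Heis n) :
    MeasurePreserving fun a : Heis n => hMul a b := by
  convert measurePreserving_shear b.1 b.2.1
    (fun x y => b.2.2 + 2 * ((∑ i, y i * b.1 i) - ∑ i, x i * b.2.1 i)) (by fun_prop) using 2 with ξ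
  simp only [hMul, Prod.mk.injEq]
  exact ⟨trivial, trivial, by ring⟩

/-- The anisotropic box `{|x_i| ≤ r, |y_i| ≤ r, |t| ≤ r²}`. -/
def hBox (n : ℕ) (r : ℝ) : Set (Heis n) :=
  Metric.closedBall 0 r ×ˢ (Metric.closedBall 0 r ×ˢ Metric.closedBall 0 (r ^ 2))

lemma mem_hBox {r : ℝ} {η : Heis n} :
    η ∈ hBox n r ↔ ‖η.1‖ ≤ r ∧ ‖η.2.1‖ ≤ r ∧ |η.2.2| ≤ r ^ 2 := by
  simp [hBox]

lemma isCompact_hBox (r : ℝ) : IsCompact (hBox n r) :=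
  (isCompact_closedBall _ _).prod ((isCompact_closedBall _ _).prod (isCompact_closedBall _ _))

lemma measurableSet_hBox (r : ℝ) : MeasurableSet (hBox n r) :=
  (isCompact_hBox r).measurableSet

lemma hBox_mono {r s : ℝ} (hr : 0 ≤ r) (h : r ≤ s) : hBox n r ⊆ hBox n s := by
  intro η
  simp only [mem_hBox]
  rintro ⟨h1, h2, h3⟩
  exact ⟨h1.trans h, h2.trans h, h3.trans (by gcongr)⟩

lemma volume_hBox {r : ℝ} (hr : 0 ≤ r) :
    volume (hBox n r) = ENNReal.ofReal (2 ^ (2 * n + 1) * r ^ (2 * n + 2)) := by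
  rw [hBox, Measure.volume_eq_prod, Measure.prod_prod, Measure.volume_eq_prod, Measure.prod_prod,
    Real.volume_pi_closedBall _ hr, Real.volume_closedBall,
    ← ENNReal.ofReal_mul (by positivity), ← ENNReal.ofReal_mul (by positivity)]
  congr 1
  simp only [Fintype.card_fin]
  ring

lemma neg_mem_hBox {r : ℝ} {η : Heis n} (h : η ∈ hBox n r) : -η ∈ hBox n r := by
  simpa [mem_hBox] using h

lemma abs_sum_mul_le {r s : ℝ} (hr : 0 ≤ r) {a b : Fin n → ℝ} (ha : ‖a‖ ≤ r) (hb : ‖b‖ ≤ s) :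
    |∑ i, a i * b i| ≤ n * (r * s) := by
  calc |∑ i, a i * b i| ≤ ∑ i, |a i * b i| := Finset.abs_sum_le_sum_abs _ _
    _ ≤ ∑ _i : Fin n, r * s := by
        refine Finset.sum_le_sum fun i _ => ?_
        rw [abs_mul]
        exact mul_le_mul ((norm_le_pi_norm a i).trans ha) ((norm_le_pi_norm b i).trans hb)
          (abs_nonneg _) hr
    _ = n * (r * s) := by simp

lemma hMul_mem_hBox {r s : ℝ} (hr : 0 ≤ r) (hs : 0 ≤ s) {a b : Heis n}
    (ha : a ∈ hBox n r) (hb : b ∈ hBox n s) :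
    hMul a b ∈ hBox n ((2 * n + 1) * (r + s)) := by
  rw [mem_hBox] at *
  obtain ⟨a1, a2, a3⟩ := ha
  obtain ⟨b1, b2, b3⟩ := hb
  have hle : r + s ≤ (2 * n + 1) * (r + s) := by
    have : (0 : ℝ) ≤ 2 * n * (r + s) := by positivity
    linarith
  refine ⟨(norm_add_le _ _).trans ((add_le_add a1 b1).trans hle),
    (norm_add_le _ _).trans ((add_le_add a2 b2).trans hle), ?_⟩
  have h1 := abs_sum_mul_le hr a2 b1
  have h2 := abs_sum_mul_le hr a1 b2
  rw [abs_le] at *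
  have h3 : r ^ 2 + s ^ 2 + 4 * (n * (r * s)) ≤ ((2 * n + 1) * (r + s)) ^ 2 := by
    have e : ((2 * n + 1) * (r + s)) ^ 2 = r ^ 2 + s ^ 2 + 4 * (n * (r * s)) +
      (2 * (r * s) + 4 * n * (n + 1) * (r + s) ^ 2 - 4 * (n * (r * s))) := by ring
    have e2 : (0 : ℝ) ≤ n * (r - s) ^ 2 := by positivity
    have e3 : (0 : ℝ) ≤ n ^ 2 * (r + s) ^ 2 := by positivity
    have e4 : (0 : ℝ) ≤ n * (r + s) ^ 2 := by positivity
    have e5 : 0 ≤ r * s := by positivity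
    have e6 : (0 : ℝ) ≤ n * (r * s) := by positivity
    nlinarith
  simp only [hMul]
  constructor <;> linarith [h1.1, h1.2, h2.1, h2.2]

end HeisenbergGroup

section HorizontalSegments

variable {n : ℕ} {u : Heis n → ℝ}

lemma abs_Xd_le_hGradNorm (i : Fin n) (ξ : Heis n) : |Xd u i ξ| ≤ hGradNorm u ξ := by
  refine Real.abs_le_sqrt ?_
  calc Xd u i ξ ^ 2 ≤ Xd u i ξ ^ 2 + Yd u i ξ ^ 2 := le_add_of_nonneg_right (sq_nonneg _)
    _ ≤ _ := Finset.single_le_sum (f := fun i => Xd u i ξ ^ 2 + Yd u i ξ ^ 2)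
        (fun j _ => by positivity) (Finset.mem_univ i)

lemma abs_Yd_le_hGradNorm (i : Fin n) (ξ : Heis n) : |Yd u i ξ| ≤ hGradNorm u ξ := by
  refine Real.abs_le_sqrt ?_
  calc Yd u i ξ ^ 2 ≤ Xd u i ξ ^ 2 + Yd u i ξ ^ 2 := le_add_of_nonneg_left (sq_nonneg _)
    _ ≤ _ := Finset.single_le_sum (f := fun i => Xd u i ξ ^ 2 + Yd u i ξ ^ 2)
        (fun j _ => by positivity) (Finset.mem_univ i)

lemma continuous_hGradNorm (hu : ContDiff ℝ 1 u) : Continuous (hGradNorm u) := by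
  have h := hu.continuous_fderiv one_ne_zero
  unfold hGradNorm Xd Yd
  fun_prop

/-- The enormed horizontal gradient. -/
def hGrad (u : Heis n → ℝ) (ξ : Heis n) : ℝ≥0∞ := ENNReal.ofReal (hGradNorm u ξ)

lemma measurable_hGrad (hu : ContDiff ℝ 1 u) : Measurable (hGrad u) :=
  (ENNReal.continuous_ofReal.comp (continuous_hGradNorm hu)).measurable

lemma fderiv_horizontal (ξ : Heis n) (a b : Fin n → ℝ) :
    fderiv ℝ u ξ (a, b, 2 * ((∑ i, ξ.2.1 i * a i) - ∑ i, ξ.1 i * b i)) =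
      ∑ i, (a i * Xd u i ξ + b i * Yd u i ξ) := by
  have h : ((a, b, 2 * ((∑ i, ξ.2.1 i * a i) - ∑ i, ξ.1 i * b i)) : Heis n) =
      ∑ i, (a i • ((Pi.single i 1, 0, 0) + (2 * ξ.2.1 i) • (0, 0, 1)) +
        b i • ((0, Pi.single i 1, 0) - (2 * ξ.1 i) • (0, 0, 1)) : Heis n) := by
    ext j
    · simp [Prod.fst_sum, Finset.sum_apply, Pi.single_apply]
    · simp [Prod.fst_sum, Prod.snd_sum, Finset.sum_apply, Pi.single_apply]
    · simp only [Prod.snd_sum, Prod.snd_add, Prod.snd_sub, Prod.smul_snd, smul_eq_mul]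
      rw [← Finset.sum_sub_distrib, Finset.mul_sum]
      exact Finset.sum_congr rfl fun i _ => by ring
  rw [h, map_sum]
  refine Finset.sum_congr rfl fun i _ => ?_
  simp only [map_add, map_sub, map_smul, smul_eq_mul, Xd, Yd]

lemma hasDerivAt_horizontal (hu : ContDiff ℝ 1 u) (p : Heis n) (a b : Fin n → ℝ) (σ : ℝ) :
    HasDerivAt (fun σ : ℝ => u (hMul p (σ • (a, b, 0))))
      (∑ i, (a i * Xd u i (hMul p (σ • (a, b, 0))) + b i * Yd u i (hMul p (σ • (a, b, 0))))) σ := by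
  rw [← fderiv_horizontal]
  have hpath : (fun σ : ℝ => hMul p (σ • ((a, b, 0) : Heis n))) = fun σ : ℝ =>
      p + σ • ((a, b, 2 * ((∑ i, p.2.1 i * a i) - ∑ i, p.1 i * b i)) : Heis n) := by
    funext σ
    ext i
    · simp [hMul]
    · simp [hMul]
    · simp only [hMul, Prod.smul_fst, Prod.smul_snd, Pi.smul_apply, smul_eq_mul, Prod.snd_add,
        Finset.mul_sum, mul_sub, mul_zero, add_zero]
      congr 2 <;> exact Finset.sum_congr rfl fun i _ => by ring
  have hdir : (a, b, 2 * ((∑ i, (hMul p (σ • ((a, b, 0) : Heis n))).2.1 i * a i) -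
      ∑ i, (hMul p (σ • ((a, b, 0) : Heis n))).1 i * b i)) =
      ((a, b, 2 * ((∑ i, p.2.1 i * a i) - ∑ i, p.1 i * b i)) : Heis n) := by
    simp only [hMul, Prod.smul_fst, Prod.smul_snd, Pi.add_apply, Pi.smul_apply, smul_eq_mul,
      Prod.mk.injEq, true_and, ← Finset.sum_sub_distrib]
    congr 1
    exact Finset.sum_congr rfl fun i _ => by ring
  rw [hdir]
  refine (hu.differentiable one_ne_zero _).hasFDerivAt.comp_hasDerivAt σ ?_
  rw [hpath]
  generalize ((a, b, 2 * ((∑ i, p.2.1 i * a i) - ∑ i, p.1 i * b i)) : Heis n) = v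
  simpa only [id, one_smul] using ((hasDerivAt_id σ).smul_const v).const_add p

lemma enorm_sub_le_lintegral_segment (hu : ContDiff ℝ 1 u) (p : Heis n) {a b : Fin n → ℝ} {s : ℝ}
    (ha : ‖a‖ ≤ s) (hb : ‖b‖ ≤ s) :
    ‖u (hMul p (a, b, 0)) - u p‖ₑ ≤ ENNReal.ofReal (2 * n * s) *
      ∫⁻ σ in Set.Ioc (0 : ℝ) 1, hGrad u (hMul p (σ • (a, b, 0))) := by
  have hs : 0 ≤ s := (norm_nonneg a).trans ha
  have hX : ∀ i, Continuous (Xd u i) := by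
    have h := hu.continuous_fderiv one_ne_zero
    unfold Xd; fun_prop
  have hY : ∀ i, Continuous (Yd u i) := by
    have h := hu.continuous_fderiv one_ne_zero
    unfold Yd; fun_prop
  have hpath : Continuous fun σ : ℝ => hMul p (σ • ((a, b, 0) : Heis n)) :=
    (continuous_hMul_left p).comp (by fun_prop)
  have hint := intervalIntegral.integral_eq_sub_of_hasDerivAt (a := 0) (b := 1)
    (fun σ _ => hasDerivAt_horizontal hu p a b σ)
    (Continuous.intervalIntegrable (continuous_finsetSum _ fun i _ =>
      ((continuous_const.mul ((hX i).comp hpath)).add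
        (continuous_const.mul ((hY i).comp hpath)))) _ _)
  simp only [one_smul, zero_smul, hMul_zero] at hint
  rw [← hint, intervalIntegral.integral_of_le zero_le_one, ← lintegral_const_mul' _ _
    ENNReal.ofReal_ne_top]
  refine (enorm_integral_le_lintegral_enorm _).trans (lintegral_mono fun σ => ?_)
  rw [hGrad, ← ENNReal.ofReal_mul (by positivity), Real.enorm_eq_ofReal_abs]
  refine ENNReal.ofReal_le_ofReal ?_
  set q := hMul p (σ • ((a, b, 0) : Heis n))
  calc |∑ i, (a i * Xd u i q + b i * Yd u i q)| ≤ ∑ i, |a i * Xd u i q + b i * Yd u i q| :=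
        Finset.abs_sum_le_sum_abs _ _
    _ ≤ ∑ _i : Fin n, (s * hGradNorm u q + s * hGradNorm u q) := by
        refine Finset.sum_le_sum fun i _ => (abs_add_le _ _).trans ?_
        rw [abs_mul, abs_mul]
        exact add_le_add
          (mul_le_mul ((norm_le_pi_norm a i).trans ha) (abs_Xd_le_hGradNorm i q) (abs_nonneg _) hs)
          (mul_le_mul ((norm_le_pi_norm b i).trans hb) (abs_Yd_le_hGradNorm i q) (abs_nonneg _) hs)
    _ = 2 * n * s * hGradNorm u q := by simp; ring

/-- A right translation by an element of a box changes the `L¹`-integral over a box in a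
controlled way. -/
lemma setLIntegral_comp_hMul_right_le {f : Heis n → ℝ≥0∞} {r s : ℝ}
    (hr : 0 ≤ r) (hs : 0 ≤ s) {h : Heis n} (hh : h ∈ hBox n s) :
    ∫⁻ η in hBox n r, f (hMul η h) ≤ ∫⁻ η in hBox n ((2 * n + 1) * (r + s)), f η := by
  have hemb : MeasurableEmbedding fun a : Heis n => hMul a h :=
    (continuous_hMul_right h).measurableEmbedding fun a b hab => by
      rw [← hMul_neg_cancel_right a h, ← hMul_neg_cancel_right b h]
      exact congrArg (fun z => hMul z (-h)) hab
  rw [← (measurePreserving_hMul_right h).setLIntegral_comp_preimage_emb hemb f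
    (hBox n ((2 * n + 1) * (r + s)))]
  exact lintegral_mono_set fun η hη => hMul_mem_hBox hr hs hη hh

lemma lintegral_horizontal_increment_le (hu : ContDiff ℝ 1 u) (ξ : Heis n) {a b : Fin n → ℝ}
    {r s : ℝ} (hr : 0 ≤ r) (ha : ‖a‖ ≤ s) (hb : ‖b‖ ≤ s) :
    ∫⁻ η in hBox n r, ‖u (hMul ξ (hMul η (a, b, 0))) - u (hMul ξ η)‖ₑ ≤
      ENNReal.ofReal (2 * n * s) *
        ∫⁻ η in hBox n ((2 * n + 1) * (r + s)), hGrad u (hMul ξ η) := by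
  have hs : 0 ≤ s := (norm_nonneg a).trans ha
  calc ∫⁻ η in hBox n r, ‖u (hMul ξ (hMul η (a, b, 0))) - u (hMul ξ η)‖ₑ
      ≤ ∫⁻ η in hBox n r, ENNReal.ofReal (2 * n * s) *
        ∫⁻ σ in Set.Ioc (0 : ℝ) 1, hGrad u (hMul ξ (hMul η (σ • (a, b, 0)))) := by
        refine lintegral_mono fun η => ?_
        simp only [← hMul_assoc]
        exact enorm_sub_le_lintegral_segment hu _ ha hb
    _ = ENNReal.ofReal (2 * n * s) * ∫⁻ σ in Set.Ioc (0 : ℝ) 1,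
          ∫⁻ η in hBox n r, hGrad u (hMul ξ (hMul η (σ • (a, b, 0)))) := by
        rw [lintegral_const_mul' _ _ ENNReal.ofReal_ne_top, lintegral_lintegral_swap]
        refine ((measurable_hGrad hu).comp (Continuous.measurable ?_)).aemeasurable
        refine (continuous_hMul_left ξ).comp (continuous_hMul.comp
          (by fun_prop : Continuous fun q : Heis n × ℝ => (q.1, q.2 • ((a, b, 0) : Heis n))))
    _ ≤ ENNReal.ofReal (2 * n * s) * ∫⁻ _σ in Set.Ioc (0 : ℝ) 1,
          ∫⁻ η in hBox n ((2 * n + 1) * (r + s)), hGrad u (hMul ξ η) := by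
        gcongr 1
        refine setLIntegral_mono' measurableSet_Ioc fun σ hσ => ?_
        refine setLIntegral_comp_hMul_right_le (f := fun η => hGrad u (hMul ξ η)) hr hs ?_
        have hle : ∀ c : Fin n → ℝ, ‖c‖ ≤ s → ‖σ • c‖ ≤ s := fun c hc => by
          rw [norm_smul, Real.norm_of_nonneg hσ.1.le]
          exact (mul_le_of_le_one_left (norm_nonneg _) hσ.2).trans hc
        rw [mem_hBox]
        exact ⟨hle a ha, hle b hb, by simp; positivity⟩
    _ = _ := by simp

end HorizontalSegments

section Poincare

variable {n : ℕ}

/-- A family of sets `S r` of displacements of size `≲ r` whose right translations change a smooth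
function, in `L¹` of boxes of size `r`, by at most `r` times its horizontal gradient. -/
structure IsHorizontallyControlled (S : ℝ → Set (Heis n)) : Prop where
  mono : ∀ {r s : ℝ}, 0 ≤ r → r ≤ s → S r ⊆ S s
  subset_hBox : ∃ c : ℝ, 0 ≤ c ∧ ∀ r, 0 ≤ r → S r ⊆ hBox n (c * r)
  increment_le : ∃ C c : ℝ, 0 ≤ C ∧ 0 ≤ c ∧ ∀ u : Heis n → ℝ, ContDiff ℝ 1 u → ∀ ξ r, 0 ≤ r →
    ∀ h ∈ S r, ∫⁻ η in hBox n r, ‖u (hMul ξ (hMul η h)) - u (hMul ξ η)‖ₑ ≤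
      ENNReal.ofReal (C * r) * ∫⁻ η in hBox n (c * r), hGrad u (hMul ξ η)

lemma IsHorizontallyControlled.mul {S T : ℝ → Set (Heis n)} (hS : IsHorizontallyControlled S)
    (hT : IsHorizontallyControlled T) :
    IsHorizontallyControlled fun r => Set.image2 hMul (S r) (T r) := by
  obtain ⟨c₁, hc₁, hS₁⟩ := hS.subset_hBox
  obtain ⟨c₂, hc₂, hT₁⟩ := hT.subset_hBox
  obtain ⟨C₁, d₁, hC₁, hd₁, hS₂⟩ := hS.increment_le
  obtain ⟨C₂, d₂, hC₂, hd₂, hT₂⟩ := hT.increment_le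
  refine ⟨fun hr hrs => Set.image2_subset (hS.mono hr hrs) (hT.mono hr hrs),
    ⟨(2 * n + 1) * (c₁ + c₂), by positivity, ?_⟩, ?_⟩
  · rintro r hr _ ⟨a, ha, b, hb, rfl⟩
    have := hMul_mem_hBox (by positivity) (by positivity) (hS₁ r hr ha) (hT₁ r hr hb)
    rwa [← add_mul, ← mul_assoc] at this
  · set κ : ℝ := (2 * n + 1) * (1 + c₁) with hκ
    have hκ1 : 1 ≤ κ := by
      have : (0 : ℝ) ≤ 2 * n * (1 + c₁) := by positivity
      linarith
    refine ⟨C₂ * κ + C₁, d₂ * κ + d₁, by positivity, by positivity, ?_⟩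
    rintro u hu ξ r hr _ ⟨a, ha, b, hb, rfl⟩
    have hcont : Continuous u := hu.continuous
    have hκr : r ≤ κ * r := le_mul_of_one_le_left hr hκ1
    calc ∫⁻ η in hBox n r, ‖u (hMul ξ (hMul η (hMul a b))) - u (hMul ξ η)‖ₑ
        ≤ ∫⁻ η in hBox n r, (‖u (hMul ξ (hMul (hMul η a) b)) - u (hMul ξ (hMul η a))‖ₑ +
            ‖u (hMul ξ (hMul η a)) - u (hMul ξ η)‖ₑ) := by
          refine lintegral_mono fun η => ?_
          rw [← hMul_assoc η, ← sub_add_sub_cancel _ (u (hMul ξ (hMul η a)))]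
          exact enorm_add_le _ _
      _ = (∫⁻ η in hBox n r, ‖u (hMul ξ (hMul (hMul η a) b)) - u (hMul ξ (hMul η a))‖ₑ) +
            ∫⁻ η in hBox n r, ‖u (hMul ξ (hMul η a)) - u (hMul ξ η)‖ₑ := by
          refine lintegral_add_right _ (Continuous.measurable ?_)
          have h1 := hcont.comp ((continuous_hMul_left ξ).comp (continuous_hMul_right a))
          have h2 := hcont.comp (continuous_hMul_left ξ)
          exact (h1.sub h2).enorm
      _ ≤ (∫⁻ η in hBox n (κ * r), ‖u (hMul ξ (hMul η b)) - u (hMul ξ η)‖ₑ) +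
            ENNReal.ofReal (C₁ * r) * ∫⁻ η in hBox n (d₁ * r), hGrad u (hMul ξ η) := by
          refine add_le_add ?_ (hS₂ u hu ξ r hr a ha)
          have := setLIntegral_comp_hMul_right_le
            (f := fun η => ‖u (hMul ξ (hMul η b)) - u (hMul ξ η)‖ₑ) hr (by positivity) (hS₁ r hr ha)
          rwa [show (2 * n + 1) * (r + c₁ * r) = κ * r by rw [hκ]; ring] at this
      _ ≤ ENNReal.ofReal (C₂ * (κ * r)) *
              (∫⁻ η in hBox n (d₂ * (κ * r)), hGrad u (hMul ξ η)) +
            ENNReal.ofReal (C₁ * r) * ∫⁻ η in hBox n (d₁ * r), hGrad u (hMul ξ η) := by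
          gcongr
          exact hT₂ u hu ξ _ (by positivity) b (hT.mono hr hκr hb)
      _ ≤ ENNReal.ofReal (C₂ * (κ * r)) *
              (∫⁻ η in hBox n ((d₂ * κ + d₁) * r), hGrad u (hMul ξ η)) +
            ENNReal.ofReal (C₁ * r) *
              ∫⁻ η in hBox n ((d₂ * κ + d₁) * r), hGrad u (hMul ξ η) := by
          have h1 : 0 ≤ d₁ * r := by positivity
          have h2 : 0 ≤ d₂ * (κ * r) := by positivity
          gcongr
          · exact hBox_mono h2 (by linarith)
          · exact hBox_mono h1 (by linarith)
      _ = _ := by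
          rw [← add_mul, ← ENNReal.ofReal_add (by positivity) (by positivity)]
          congr 2
          ring

lemma isHorizontallyControlled_horizontal : IsHorizontallyControlled
    fun r => {h : Heis n | ‖h.1‖ ≤ r ∧ ‖h.2.1‖ ≤ r ∧ h.2.2 = 0} := by
  refine ⟨fun _ hrs h hh => ⟨hh.1.trans hrs, hh.2.1.trans hrs, hh.2.2⟩, ⟨1, zero_le_one, ?_⟩,
    ⟨2 * n, (2 * n + 1) * 2, by positivity, by positivity, ?_⟩⟩
  · rintro r hr h ⟨h1, h2, h3⟩
    rw [mem_hBox, one_mul, h3, abs_zero]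
    exact ⟨h1, h2, by positivity⟩
  · rintro u hu ξ r hr ⟨a, b, t⟩ ⟨h1, h2, rfl⟩
    rw [show (2 * (n : ℝ) + 1) * 2 * r = (2 * n + 1) * (r + r) by ring]
    exact lintegral_horizontal_increment_le hu ξ hr h1 h2

lemma isHorizontallyControlled_hBox (hn : 1 ≤ n) : IsHorizontallyControlled (hBox n) := by
  refine ⟨hBox_mono, ⟨1, zero_le_one, fun r _ => by rw [one_mul]⟩, ?_⟩
  have hH := isHorizontallyControlled_horizontal (n := n)
  obtain ⟨C, c, hC, hc, h⟩ := ((((hH.mul hH).mul hH).mul hH).mul hH).increment_le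
  refine ⟨C, c, hC, hc, fun u hu ξ r hr η hη => h u hu ξ r hr η ?_⟩
  obtain ⟨x, y, t⟩ := η
  rw [mem_hBox] at hη
  obtain ⟨hx, hy, ht⟩ := hη
  simp only at hx hy ht
  obtain ⟨a, b, ha, hb, hab⟩ : ∃ a b : ℝ, |a| ≤ r ∧ |b| ≤ r ∧ 4 * (a * b) = t := by
    have hsq : √|t| ≤ r := Real.sqrt_le_iff.2 ⟨hr, ht⟩
    have hmul : √|t| * √|t| = |t| := Real.mul_self_sqrt (abs_nonneg t)
    have h2 : |√|t| / 2| ≤ r := by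
      rw [abs_of_nonneg (by positivity)]
      linarith [Real.sqrt_nonneg |t|]
    rcases le_total 0 t with h0 | h0
    · refine ⟨√|t| / 2, √|t| / 2, h2, h2, ?_⟩
      rw [abs_of_nonneg h0] at hmul ⊢
      linarith
    · refine ⟨√|t| / 2, -(√|t| / 2), h2, by rwa [abs_neg], ?_⟩
      rw [abs_of_nonpos h0] at hmul ⊢
      linarith
  let i₀ : Fin n := ⟨0, hn⟩
  refine ⟨_, ⟨_, ⟨_, ⟨(x, y, 0), ⟨hx, hy, rfl⟩, (0, Pi.single i₀ b, 0), ?_, rfl⟩,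
    (Pi.single i₀ a, 0, 0), ?_, rfl⟩, (0, Pi.single i₀ (-b), 0), ?_, rfl⟩,
    (Pi.single i₀ (-a), 0, 0), ?_, ?_⟩
  · exact ⟨by simpa, by simpa [Pi.norm_single] using hb, rfl⟩
  · exact ⟨by simpa [Pi.norm_single] using ha, by simpa, rfl⟩
  · exact ⟨by simpa, by simpa [Pi.norm_single] using hb, rfl⟩
  · exact ⟨by simpa [Pi.norm_single] using ha, by simpa, rfl⟩
  · ext i
    · simp [hMul, add_assoc, ← Pi.single_add]
    · simp [hMul, add_assoc, ← Pi.single_add]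
    · simp [hMul, Pi.single_apply, add_mul, mul_add]
      linarith

/-- A weak `L¹` Poincaré inequality on boxes. -/
lemma exists_lintegral_oscillation_le (hn : 1 ≤ n) : ∃ C c : ℝ, 0 ≤ C ∧ 0 ≤ c ∧
    ∀ u : Heis n → ℝ, ContDiff ℝ 1 u → ∀ ξ r, 0 ≤ r →
      ∫⁻ η in hBox n r, ∫⁻ η' in hBox n r, ‖u (hMul ξ η') - u (hMul ξ η)‖ₑ ≤
        ENNReal.ofReal (C * r ^ (2 * n + 3)) *
          ∫⁻ η in hBox n (c * r), hGrad u (hMul ξ η) := by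
  obtain ⟨C, c, hC, hc, hinc⟩ := (isHorizontallyControlled_hBox hn).increment_le
  set κ : ℝ := (2 * n + 1) * 2 with hκ
  have hκ1 : 1 ≤ κ := by
    have : (0 : ℝ) ≤ n := by positivity
    linarith
  refine ⟨2 ^ (2 * n + 1) * κ ^ (2 * n + 2) * (C * κ), c * κ, by positivity, by positivity,
    fun u hu ξ r hr => ?_⟩
  have hemb : ∀ η : Heis n, MeasurableEmbedding (hMul η) := fun η =>
    (continuous_hMul_left η).measurableEmbedding fun a b hab => by
      rw [← neg_hMul_cancel_left η a, hab, neg_hMul_cancel_left]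
  have hκr : r ≤ κ * r := le_mul_of_one_le_left hr hκ1
  have hcont : Continuous u := hu.continuous
  calc ∫⁻ η in hBox n r, ∫⁻ η' in hBox n r, ‖u (hMul ξ η') - u (hMul ξ η)‖ₑ
      ≤ ∫⁻ η in hBox n r, ∫⁻ h in hBox n (κ * r),
          ‖u (hMul ξ (hMul η h)) - u (hMul ξ η)‖ₑ := by
        refine setLIntegral_mono' (measurableSet_hBox r) fun η hη => ?_
        rw [← (measurePreserving_hMul_left η).setLIntegral_comp_preimage_emb (hemb η)
          (fun η' => ‖u (hMul ξ η') - u (hMul ξ η)‖ₑ) (hBox n r)]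
        refine lintegral_mono_set fun h hh => ?_
        have := hMul_mem_hBox hr hr (neg_mem_hBox hη) hh
        rwa [neg_hMul_cancel_left, ← two_mul, ← mul_assoc] at this
    _ = ∫⁻ h in hBox n (κ * r), ∫⁻ η in hBox n r,
          ‖u (hMul ξ (hMul η h)) - u (hMul ξ η)‖ₑ := by
        refine lintegral_lintegral_swap (Continuous.measurable ?_).aemeasurable
        have h1 := hcont.comp ((continuous_hMul_left ξ).comp (continuous_hMul (n := n)))
        have h2 : Continuous fun q : Heis n × Heis n => u (hMul ξ q.1) :=
          (hcont.comp (continuous_hMul_left ξ)).comp continuous_fst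
        exact (h1.sub h2).enorm
    _ ≤ ∫⁻ _h in hBox n (κ * r), ENNReal.ofReal (C * (κ * r)) *
          ∫⁻ η in hBox n (c * (κ * r)), hGrad u (hMul ξ η) := by
        refine setLIntegral_mono' (measurableSet_hBox _) fun h hh => ?_
        exact (lintegral_mono_set (hBox_mono hr hκr)).trans
          (hinc u hu ξ _ (by positivity) h hh)
    _ = _ := by
        rw [setLIntegral_const, volume_hBox (by positivity), mul_right_comm,
          ← ENNReal.ofReal_mul (by positivity), ← mul_assoc c]
        congr 2
        rw [mul_pow, pow_succ r (2 * n + 2)]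
        ring

end Poincare

section PointwiseBound

variable {n : ℕ}

/-- The mean of `‖f - z‖` over a set is controlled by its mean over another set plus the mean
oscillation between both sets. -/
lemma lintegral_mean_sub_le {X : Type*} [MeasurableSpace X] {μ : Measure X} {f : X → ℝ}
    (hf : Measurable f) (z : ℝ) {A B : Set X} (hA : μ A ≠ 0) (hA' : μ A ≠ ⊤)
    (hB : μ B ≠ 0) (hB' : μ B ≠ ⊤) :
    (μ A)⁻¹ * ∫⁻ x in A, ‖f x - z‖ₑ ∂μ ≤
      (μ B)⁻¹ * (μ A)⁻¹ * (∫⁻ y in B, ∫⁻ x in A, ‖f x - f y‖ₑ ∂μ ∂μ) +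
        (μ B)⁻¹ * ∫⁻ y in B, ‖f y - z‖ₑ ∂μ := by
  have hconst : ∀ c : ℝ≥0∞, (μ B)⁻¹ * ∫⁻ _y in B, c ∂μ = c := fun c => by
    rw [setLIntegral_const, mul_left_comm, ENNReal.inv_mul_cancel hB hB', mul_one]
  have hconst' : ∀ c : ℝ≥0∞, (μ A)⁻¹ * ∫⁻ _y in A, c ∂μ = c := fun c => by
    rw [setLIntegral_const, mul_left_comm, ENNReal.inv_mul_cancel hA hA', mul_one]
  calc (μ A)⁻¹ * ∫⁻ x in A, ‖f x - z‖ₑ ∂μ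
      = (μ B)⁻¹ * ∫⁻ _y in B, ((μ A)⁻¹ * ∫⁻ x in A, ‖f x - z‖ₑ ∂μ) ∂μ := (hconst _).symm
    _ ≤ (μ B)⁻¹ * ∫⁻ y in B,
          ((μ A)⁻¹ * (∫⁻ x in A, ‖f x - f y‖ₑ ∂μ) + ‖f y - z‖ₑ) ∂μ := by
        gcongr with y
        calc (μ A)⁻¹ * ∫⁻ x in A, ‖f x - z‖ₑ ∂μ
            ≤ (μ A)⁻¹ * ∫⁻ x in A, (‖f x - f y‖ₑ + ‖f y - z‖ₑ) ∂μ := by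
              gcongr with x
              rw [← sub_add_sub_cancel _ (f y)]
              exact enorm_add_le _ _
          _ = _ := by
              rw [lintegral_add_right _ measurable_const, mul_add, hconst']
    _ = _ := by
        rw [lintegral_add_right (g := fun y => ‖f y - z‖ₑ) _ (hf.sub measurable_const).enorm,
          mul_add, mul_assoc, lintegral_const_mul' _ _ (ENNReal.inv_ne_top.2 hA)]

lemma volume_hBox_ne_zero {r : ℝ} (hr : 0 < r) : volume (hBox n r) ≠ 0 := by
  rw [volume_hBox hr.le]
  simp only [ne_eq, ENNReal.ofReal_eq_zero, not_le]
  positivity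

lemma volume_hBox_ne_top (r : ℝ) : volume (hBox n r) ≠ ⊤ :=
  (isCompact_hBox r).measure_lt_top.ne

lemma tendsto_mean_sub_hBox {u : Heis n → ℝ} (hu : Continuous u) (ξ : Heis n) :
    Filter.Tendsto (fun k : ℕ => (volume (hBox n ((1 / 2) ^ k)))⁻¹ *
      ∫⁻ η in hBox n ((1 / 2) ^ k), ‖u (hMul ξ η) - u ξ‖ₑ) Filter.atTop (nhds 0) := by
  rw [ENNReal.tendsto_atTop_zero]
  intro ε hε
  have hcont : Continuous fun η => ‖u (hMul ξ η) - u ξ‖ₑ :=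
    ((hu.comp (continuous_hMul_left ξ)).sub continuous_const).enorm
  have hev : ∀ᶠ η in nhds (0 : Heis n), ‖u (hMul ξ η) - u ξ‖ₑ ≤ ε := by
    have h0 : ‖u (hMul ξ 0) - u ξ‖ₑ < ε := by simpa [hMul_zero] using hε
    exact (hcont.continuousAt.eventually_lt continuousAt_const h0).mono fun _ h => h.le
  obtain ⟨δ, hδ, hball⟩ := Metric.eventually_nhds_iff_ball.1 hev
  obtain ⟨N, hN⟩ := exists_pow_lt_of_lt_one hδ (by norm_num : (1 / 2 : ℝ) < 1)
  refine ⟨N, fun k hk => ?_⟩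
  set r : ℝ := (1 / 2) ^ k
  have hr : 0 < r := by positivity
  have hr1 : r ≤ 1 := pow_le_one₀ (by norm_num) (by norm_num)
  have hrδ : r < δ := (pow_le_pow_of_le_one (by norm_num) (by norm_num) hk).trans_lt hN
  calc (volume (hBox n r))⁻¹ * ∫⁻ η in hBox n r, ‖u (hMul ξ η) - u ξ‖ₑ
      ≤ (volume (hBox n r))⁻¹ * ∫⁻ _η in hBox n r, ε := by
        gcongr 1
        refine setLIntegral_mono' (measurableSet_hBox r) fun η hη => hball η ?_
        rw [mem_hBox] at hη
        rw [mem_ball_zero_iff]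
        have h3 : ‖η.2.2‖ ≤ r := hη.2.2.trans (by nlinarith)
        exact (norm_prod_le_iff.2 ⟨hη.1, norm_prod_le_iff.2 ⟨hη.2.1, h3⟩⟩).trans_lt hrδ
    _ = ε := by
        rw [setLIntegral_const, mul_left_comm,
          ENNReal.inv_mul_cancel (volume_hBox_ne_zero hr) (volume_hBox_ne_top r), mul_one]

/-- A smooth function is pointwise bounded by its local mean plus a discretised Riesz potential of
its horizontal gradient. -/
lemma exists_enorm_le_mean_add_potential (hn : 1 ≤ n) : ∃ C c : ℝ, 0 < C ∧ 1 ≤ c ∧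
    ∀ u : Heis n → ℝ, ContDiff ℝ 1 u → ∀ ξ,
      ‖u ξ‖ₑ ≤ ENNReal.ofReal C * (∫⁻ η in hBox n c, ‖u (hMul ξ η)‖ₑ) +
        ENNReal.ofReal C * ∑' k : ℕ, ENNReal.ofReal ((2 ^ k) ^ (2 * n + 1)) *
          ∫⁻ η in hBox n (c * (1 / 2) ^ k), hGrad u (hMul ξ η) := by
  obtain ⟨C, c, hC, hc, hosc⟩ := exists_lintegral_oscillation_le (n := n) hn
  set V : ℝ := 2 ^ (2 * n + 1) with hV
  have hV0 : 0 < V := by positivity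
  set C' : ℝ := C * 2 ^ (2 * n + 2) / V ^ 2
  have hC' : 0 ≤ C' := by positivity
  refine ⟨C' + V⁻¹, c + 1, by positivity, by linarith, fun u hu ξ => ?_⟩
  have hcont : Continuous u := hu.continuous
  have hcontξ : Continuous fun η => u (hMul ξ η) := hcont.comp (continuous_hMul_left ξ)
  let r : ℕ → ℝ := fun k => (1 / 2) ^ k
  have hr : ∀ k, 0 < r k := fun k => by positivity
  let d : ℕ → ℝ≥0∞ := fun k => (volume (hBox n (r k)))⁻¹ *
    ∫⁻ η in hBox n (r k), ‖u (hMul ξ η) - u ξ‖ₑ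
  let E : ℕ → ℝ≥0∞ := fun k => ENNReal.ofReal ((2 ^ k) ^ (2 * n + 1)) *
    ∫⁻ η in hBox n ((c + 1) * r k), hGrad u (hMul ξ η)
  have hstep : ∀ k, d k ≤ ENNReal.ofReal C' * E k + d (k + 1) := fun k => by
    have hsub : hBox n (r (k + 1)) ⊆ hBox n (r k) :=
      hBox_mono (hr _).le (pow_le_pow_of_le_one (by norm_num) (by norm_num) (Nat.le_succ k))
    refine (lintegral_mean_sub_le hcontξ.measurable (u ξ) (volume_hBox_ne_zero (hr k))
      (volume_hBox_ne_top _) (volume_hBox_ne_zero (hr (k + 1))) (volume_hBox_ne_top _)).trans ?_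
    refine add_le_add ?_ le_rfl
    calc (volume (hBox n (r (k + 1))))⁻¹ * (volume (hBox n (r k)))⁻¹ *
          (∫⁻ η in hBox n (r (k + 1)), ∫⁻ η' in hBox n (r k), ‖u (hMul ξ η') - u (hMul ξ η)‖ₑ)
        ≤ (volume (hBox n (r (k + 1))))⁻¹ * (volume (hBox n (r k)))⁻¹ *
          (ENNReal.ofReal (C * r k ^ (2 * n + 3)) *
            ∫⁻ η in hBox n ((c + 1) * r k), hGrad u (hMul ξ η)) := by
          gcongr
          refine (lintegral_mono_set hsub).trans ((hosc u hu ξ _ (hr k).le).trans ?_)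
          have h0 : 0 ≤ c * r k := mul_nonneg hc (hr k).le
          gcongr
          exact hBox_mono h0 (by linarith [hr k])
      _ = ENNReal.ofReal C' * E k := by
          have hk := hr k
          simp only [E]
          rw [volume_hBox (hr _).le, volume_hBox (hr _).le,
            ← ENNReal.ofReal_inv_of_pos (by have := hr (k + 1); positivity),
            ← ENNReal.ofReal_inv_of_pos (by positivity),
            ← ENNReal.ofReal_mul (by have := hr (k + 1); positivity), ← mul_assoc,
            ← ENNReal.ofReal_mul (by have := hr (k + 1); positivity),
            ← mul_assoc (ENNReal.ofReal C'),
            ← ENNReal.ofReal_mul hC']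
          congr 2
          have h2 : (2 : ℝ) ^ k = (r k)⁻¹ := by simp [r]
          have h3 : r (k + 1) = r k / 2 := by simp [r, pow_succ]; ring
          rw [h2, h3, ← hV]
          simp only [C']
          rw [div_pow, inv_pow]
          field_simp
          ring
  have hiter : ∀ K, d 0 ≤ ENNReal.ofReal C' * ∑ k ∈ Finset.range K, E k + d K := fun K => by
    induction K with
    | zero => simp
    | succ K ih =>
      refine ih.trans ?_
      rw [Finset.sum_range_succ, mul_add, add_assoc]
      gcongr
      exact hstep K
  have hd0 : d 0 ≤ ENNReal.ofReal C' * ∑' k, E k := by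
    have hlim : Filter.Tendsto (fun K => ENNReal.ofReal C' * ∑' k, E k + d K) Filter.atTop
        (nhds (ENNReal.ofReal C' * (∑' k, E k) + 0)) :=
      tendsto_const_nhds.add (tendsto_mean_sub_hBox hcont ξ)
    rw [add_zero] at hlim
    refine ge_of_tendsto' hlim fun K => (hiter K).trans ?_
    gcongr
    exact ENNReal.sum_le_tsum _
  have hvol : volume (hBox n (1 : ℝ)) = ENNReal.ofReal V := by
    rw [volume_hBox zero_le_one, one_pow, mul_one]
  have hd0eq : d 0 = ENNReal.ofReal V⁻¹ * ∫⁻ η in hBox n 1, ‖u (hMul ξ η) - u ξ‖ₑ := by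
    simp only [d, r, pow_zero, hvol, ENNReal.ofReal_inv_of_pos hV0]
  calc ‖u ξ‖ₑ = ENNReal.ofReal V⁻¹ * ∫⁻ _η in hBox n 1, ‖u ξ‖ₑ := by
        rw [setLIntegral_const, hvol, mul_left_comm, ← ENNReal.ofReal_mul (by positivity),
          inv_mul_cancel₀ hV0.ne', ENNReal.ofReal_one, mul_one]
    _ ≤ ENNReal.ofReal V⁻¹ *
          ∫⁻ η in hBox n 1, (‖u (hMul ξ η)‖ₑ + ‖u (hMul ξ η) - u ξ‖ₑ) := by
        gcongr with η
        calc ‖u ξ‖ₑ = ‖u (hMul ξ η) - (u (hMul ξ η) - u ξ)‖ₑ := by rw [_root_.sub_sub_cancel]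
          _ ≤ _ := enorm_sub_le
    _ = ENNReal.ofReal V⁻¹ * (∫⁻ η in hBox n 1, ‖u (hMul ξ η)‖ₑ) + d 0 := by
        rw [lintegral_add_left hcontξ.enorm.measurable, mul_add, hd0eq]
    _ ≤ _ := by
        refine add_le_add ?_ (hd0.trans ?_)
        · gcongr
          · linarith
          · exact hBox_mono zero_le_one (by linarith)
        · gcongr
          have : 0 < V⁻¹ := by positivity
          linarith

end PointwiseBound

section KernelEstimates

lemma sum_range_two_pow_mul_le {m : ℕ} (hm : 1 ≤ m) (K : ℕ) :
    ∑ k ∈ Finset.range K, (2 : ℝ≥0∞) ^ (k * m) ≤ 2 ^ (K * m) := by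
  induction K with
  | zero => simp
  | succ K ih =>
    rw [Finset.sum_range_succ, add_mul, one_mul, pow_add]
    calc _ ≤ (2 : ℝ≥0∞) ^ (K * m) + 2 ^ (K * m) := by gcongr
      _ = 2 ^ (K * m) * 2 ^ 1 := by ring
      _ ≤ _ := by gcongr; norm_num

lemma sum_indicator_rpow_le {X : Type*} {m : ℕ} (hm : 1 ≤ m) (B : ℕ → Set X) (x : X) (K : ℕ) :
    (∑ k ∈ Finset.range K, (B k).indicator (fun _ => (2 : ℝ≥0∞) ^ (k * m)) x) ^
        (((m : ℝ) + 1) / m) ≤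
      4 * ∑ k ∈ Finset.range K, (B k).indicator (fun _ => (2 : ℝ≥0∞) ^ (k * (m + 1))) x := by
  have hm0 : (0 : ℝ) < m := by exact_mod_cast hm
  have hm1 : (1 : ℝ) ≤ m := by exact_mod_cast hm
  have hq : 0 < ((m : ℝ) + 1) / m := by positivity
  induction K with
  | zero => simp [hq]
  | succ K ih =>
    by_cases hx : x ∈ B K
    · calc (∑ k ∈ Finset.range (K + 1), (B k).indicator (fun _ => (2 : ℝ≥0∞) ^ (k * m)) x) ^
            (((m : ℝ) + 1) / m)
          ≤ (2 * 2 ^ (K * m)) ^ (((m : ℝ) + 1) / m) := by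
            gcongr
            rw [Finset.sum_range_succ, two_mul]
            gcongr
            · refine le_trans (Finset.sum_le_sum fun k _ => ?_) (sum_range_two_pow_mul_le hm K)
              exact Set.indicator_le_self' (fun _ _ => zero_le) x
            · exact Set.indicator_le_self' (fun _ _ => zero_le) x
        _ = 2 ^ (((m : ℝ) + 1) / m) * 2 ^ (K * (m + 1)) := by
            rw [ENNReal.mul_rpow_of_nonneg _ _ hq.le, ← ENNReal.rpow_natCast,
              ← ENNReal.rpow_natCast, ← ENNReal.rpow_mul]
            congr 2
            push_cast
            field_simp
        _ ≤ 4 * 2 ^ (K * (m + 1)) := by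
            gcongr
            calc (2 : ℝ≥0∞) ^ (((m : ℝ) + 1) / m) ≤ 2 ^ (2 : ℝ) := by
                  refine ENNReal.rpow_le_rpow_of_exponent_le one_le_two ?_
                  rw [div_le_iff₀ hm0]
                  linarith
              _ = 4 := by
                  rw [ENNReal.rpow_two]
                  norm_num
        _ ≤ _ := by
            gcongr
            refine le_trans (le_of_eq ?_) (Finset.single_le_sum (fun _ _ => zero_le)
              (Finset.self_mem_range_succ K))
            simp [hx]
    · simpa [Finset.sum_range_succ, hx] using ih

/-- The `L^{m+1}`-bound, with sharp growth in the number of scales, of a truncated discretised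
potential. -/
lemma sum_mul_setLIntegral_le {X : Type*} [MeasurableSpace X] {μ : Measure X} {m : ℕ}
    (hm : 1 ≤ m) {B : ℕ → Set X} (hB : ∀ k, MeasurableSet (B k)) {v : ℝ≥0∞}
    (hv : ∀ k, 2 ^ (k * (m + 1)) * μ (B k) ≤ v) {F : X → ℝ≥0∞} (hF : Measurable F) (K : ℕ) :
    ∑ k ∈ Finset.range K, 2 ^ (k * m) * ∫⁻ x in B k, F x ∂μ ≤
      (4 * (K * v)) ^ ((m : ℝ) / (m + 1)) * (∫⁻ x, F x ^ (m + 1) ∂μ) ^ (1 / ((m : ℝ) + 1)) := by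
  have hm0 : (0 : ℝ) < m := by exact_mod_cast hm
  have hconj : (((m : ℝ) + 1) / m).HolderConjugate ((m : ℝ) + 1) := by
    rw [Real.holderConjugate_iff]
    refine ⟨(one_lt_div hm0).2 (by linarith), ?_⟩
    field_simp
  set Φ : X → ℝ≥0∞ := fun x =>
    ∑ k ∈ Finset.range K, (B k).indicator (fun _ => (2 : ℝ≥0∞) ^ (k * m)) x with hΦ
  have hind : ∀ (a : ℕ → ℝ≥0∞) k, Measurable ((B k).indicator fun _ => a k) := fun a k =>
    measurable_const.indicator (hB k)
  have hΦm : Measurable Φ := Finset.measurable_sum _ fun k _ => hind (fun k => 2 ^ (k * m)) k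
  calc ∑ k ∈ Finset.range K, 2 ^ (k * m) * ∫⁻ x in B k, F x ∂μ
      = ∫⁻ x, (Φ * F) x ∂μ := by
        simp only [hΦ, Pi.mul_apply, Finset.sum_mul]
        rw [lintegral_finsetSum (f := fun k x =>
          (B k).indicator (fun _ => (2 : ℝ≥0∞) ^ (k * m)) x * F x) _
          fun k _ => (hind (fun k => 2 ^ (k * m)) k).mul hF]
        refine Finset.sum_congr rfl fun k _ => ?_
        rw [← lintegral_const_mul _ hF, ← lintegral_indicator (hB k)]
        refine lintegral_congr fun x => ?_
        by_cases hx : x ∈ B k <;> simp [hx]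
    _ ≤ (∫⁻ x, Φ x ^ (((m : ℝ) + 1) / m) ∂μ) ^ (1 / (((m : ℝ) + 1) / m)) *
          (∫⁻ x, F x ^ ((m : ℝ) + 1) ∂μ) ^ (1 / ((m : ℝ) + 1)) :=
        ENNReal.lintegral_mul_le_Lp_mul_Lq μ hconj hΦm.aemeasurable hF.aemeasurable
    _ = (∫⁻ x, Φ x ^ (((m : ℝ) + 1) / m) ∂μ) ^ ((m : ℝ) / (m + 1)) *
          (∫⁻ x, F x ^ (m + 1) ∂μ) ^ (1 / ((m : ℝ) + 1)) := by
        rw [one_div_div]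
        congr 3 with x
        exact_mod_cast ENNReal.rpow_natCast (F x) (m + 1)
    _ ≤ _ := by
        gcongr
        calc ∫⁻ x, Φ x ^ (((m : ℝ) + 1) / m) ∂μ
            ≤ ∫⁻ x, 4 * ∑ k ∈ Finset.range K,
                (B k).indicator (fun _ => (2 : ℝ≥0∞) ^ (k * (m + 1))) x ∂μ :=
              lintegral_mono fun x => sum_indicator_rpow_le hm B x K
          _ = 4 * ∑ k ∈ Finset.range K, 2 ^ (k * (m + 1)) * μ (B k) := by
              rw [lintegral_const_mul _ (Finset.measurable_sum _ fun k _ =>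
                  hind (fun k => 2 ^ (k * (m + 1))) k),
                lintegral_finsetSum _ fun k _ => hind (fun k => 2 ^ (k * (m + 1))) k]
              simp only [lintegral_indicator_const (hB _)]
          _ ≤ 4 * ∑ _k ∈ Finset.range K, v := by
              gcongr with k
              exact hv k
          _ = 4 * (K * v) := by simp

lemma lintegral_mul_pow_le {X : Type*} [MeasurableSpace X] {μ : Measure X} {m : ℕ}
    (hm : 1 ≤ m) {Ψ F : X → ℝ≥0∞} (hΨ : Measurable Ψ) (hF : Measurable F) :
    (∫⁻ x, Ψ x * F x ∂μ) ^ (m + 1) ≤ (∫⁻ x, Ψ x ∂μ) ^ m * ∫⁻ x, Ψ x * F x ^ (m + 1) ∂μ := by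
  have hm0 : (0 : ℝ) < m := by exact_mod_cast hm
  have hconj : (((m : ℝ) + 1) / m).HolderConjugate ((m : ℝ) + 1) := by
    rw [Real.holderConjugate_iff]
    refine ⟨(one_lt_div hm0).2 (by linarith), ?_⟩
    field_simp
  have h := ENNReal.lintegral_mul_le_Lp_mul_Lq (μ.withDensity Ψ) hconj
    (measurable_const (a := (1 : ℝ≥0∞))).aemeasurable hF.aemeasurable
  have hpow : ∀ x, F x ^ ((m : ℝ) + 1) = F x ^ (m + 1) := fun x => by
    exact_mod_cast ENNReal.rpow_natCast (F x) (m + 1)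
  simp only [Pi.mul_apply, one_mul, ENNReal.one_rpow, hpow, one_div_div] at h
  rw [lintegral_withDensity_eq_lintegral_mul _ hΨ hF,
    lintegral_withDensity_eq_lintegral_mul _ hΨ measurable_const,
    lintegral_withDensity_eq_lintegral_mul _ hΨ (hF.pow_const _)] at h
  simp only [Pi.mul_apply, mul_one] at h
  have hcast : ((m + 1 : ℕ) : ℝ) = (m : ℝ) + 1 := by push_cast; ring
  calc (∫⁻ x, Ψ x * F x ∂μ) ^ (m + 1)
      ≤ ((∫⁻ x, Ψ x ∂μ) ^ ((m : ℝ) / (m + 1)) *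
          (∫⁻ x, Ψ x * F x ^ (m + 1) ∂μ) ^ (1 / ((m : ℝ) + 1))) ^ (m + 1) := by gcongr
    _ = _ := by
        rw [mul_pow, ← ENNReal.rpow_natCast, ← ENNReal.rpow_natCast, ← ENNReal.rpow_mul,
          ← ENNReal.rpow_mul, hcast, div_mul_cancel₀ _ (by positivity),
          div_mul_cancel₀ _ (by positivity), ENNReal.rpow_one, ENNReal.rpow_natCast]

variable {n : ℕ}

lemma lintegral_tail_potential_pow_le {m : ℕ} (hm : 1 ≤ m) {B : ℕ → Set (Heis n)}
    (hB : ∀ k, MeasurableSet (B k)) {v : ℝ≥0∞} (hv : ∀ k, 2 ^ (k * (m + 1)) * volume (B k) ≤ v)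
    {G : Heis n → ℝ≥0∞} (hG : Measurable G) (K : ℕ) :
    ∫⁻ ξ, (∑' k, 2 ^ ((k + K) * m) * ∫⁻ η in B (k + K), G (hMul ξ η)) ^ (m + 1) ≤
      (2 * v * 2⁻¹ ^ K) ^ (m + 1) * ∫⁻ ξ, G ξ ^ (m + 1) := by
  set Ψ : Heis n → ℝ≥0∞ := fun η =>
    ∑' k, (B (k + K)).indicator (fun _ => (2 : ℝ≥0∞) ^ ((k + K) * m)) η with hΨdef
  have hind : ∀ k, Measurable ((B (k + K)).indicator fun _ => (2 : ℝ≥0∞) ^ ((k + K) * m)) :=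
    fun k => measurable_const.indicator (hB _)
  have hΨ : Measurable Ψ := Measurable.tsum hind
  have hGξ : ∀ ξ, Measurable fun η => G (hMul ξ η) := fun ξ =>
    hG.comp (continuous_hMul_left ξ).measurable
  have hint : ∫⁻ η, Ψ η ≤ 2 * v * 2⁻¹ ^ K := by
    rw [hΨdef, lintegral_tsum fun k => (hind k).aemeasurable]
    calc ∑' k, ∫⁻ η, (B (k + K)).indicator (fun _ => (2 : ℝ≥0∞) ^ ((k + K) * m)) η
        ≤ ∑' k, v * 2⁻¹ ^ K * 2⁻¹ ^ k := by
          refine ENNReal.tsum_le_tsum fun k => ?_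
          rw [lintegral_indicator_const (hB _)]
          calc (2 : ℝ≥0∞) ^ ((k + K) * m) * volume (B (k + K))
              = 2 ^ ((k + K) * (m + 1)) * volume (B (k + K)) * 2⁻¹ ^ (k + K) := by
                rw [mul_add, mul_one, pow_add, mul_right_comm, mul_assoc (2 ^ _) (2 ^ _),
                  ← mul_pow, ENNReal.mul_inv_cancel two_ne_zero ENNReal.ofNat_ne_top, one_pow,
                  mul_one]
            _ ≤ v * 2⁻¹ ^ (k + K) := by gcongr; exact hv _
            _ = v * 2⁻¹ ^ K * 2⁻¹ ^ k := by ring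
      _ = 2 * v * 2⁻¹ ^ K := by
          rw [ENNReal.tsum_mul_left, ENNReal.tsum_geometric, ENNReal.one_sub_inv_two, inv_inv]
          ring
  calc ∫⁻ ξ, (∑' k, 2 ^ ((k + K) * m) * ∫⁻ η in B (k + K), G (hMul ξ η)) ^ (m + 1)
      = ∫⁻ ξ, (∫⁻ η, Ψ η * G (hMul ξ η)) ^ (m + 1) := by
        refine lintegral_congr fun ξ => ?_
        congr 1
        simp only [hΨdef, ← ENNReal.tsum_mul_right]
        rw [lintegral_tsum (f := fun k η =>
          (B (k + K)).indicator (fun _ => (2 : ℝ≥0∞) ^ ((k + K) * m)) η * G (hMul ξ η))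
          fun k => ((hind k).mul (hGξ ξ)).aemeasurable]
        refine tsum_congr fun k => ?_
        rw [← lintegral_const_mul _ (hGξ ξ), ← lintegral_indicator (hB _)]
        refine lintegral_congr fun x => ?_
        by_cases hx : x ∈ B (k + K) <;> simp [hx]
    _ ≤ ∫⁻ ξ, (∫⁻ η, Ψ η) ^ m * ∫⁻ η, Ψ η * G (hMul ξ η) ^ (m + 1) :=
        lintegral_mono fun ξ => lintegral_mul_pow_le hm hΨ (hGξ ξ)
    _ = (∫⁻ η, Ψ η) ^ m * ∫⁻ η, Ψ η * ∫⁻ ξ, G (hMul ξ η) ^ (m + 1) := by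
        have hjoint : Measurable fun q : Heis n × Heis n => Ψ q.2 * G (hMul q.1 q.2) ^ (m + 1) :=
          (hΨ.comp measurable_snd).mul ((hG.comp continuous_hMul.measurable).pow_const _)
        rw [lintegral_const_mul _ hjoint.lintegral_prod_right',
          lintegral_lintegral_swap hjoint.aemeasurable]
        congr 1
        refine lintegral_congr fun η => ?_
        exact lintegral_const_mul (μ := volume) (f := fun ξ => G (hMul ξ η) ^ (m + 1)) (Ψ η)
          ((hG.comp (continuous_hMul_right η).measurable).pow_const _)
    _ = (∫⁻ η, Ψ η) ^ (m + 1) * ∫⁻ ξ, G ξ ^ (m + 1) := by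
        have hη : ∀ η : Heis n, ∫⁻ ξ, G (hMul ξ η) ^ (m + 1) = ∫⁻ ξ, G ξ ^ (m + 1) := fun η =>
          (measurePreserving_hMul_right η).lintegral_comp (hG.pow_const _)
        simp only [hη]
        rw [lintegral_mul_const _ hΨ]
        ring
    _ ≤ _ := by gcongr

end KernelEstimates

section Decay

variable {n : ℕ}

lemma exists_isCompact_setLIntegral_compl_le {f : Heis n → ℝ≥0∞} (hf : ∫⁻ x, f x ≠ ⊤)
    {ε : ℝ≥0∞} (hε : ε ≠ 0) : ∃ S, IsCompact S ∧ ∫⁻ x in Sᶜ, f x ≤ ε := by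
  have := isFiniteMeasure_withDensity hf
  obtain ⟨S, -, hS, hlt⟩ := (MeasurableSet.univ (α := Heis n)).exists_isCompact_sdiff_lt
    (measure_ne_top (volume.withDensity f) _) hε
  refine ⟨S, hS, ?_⟩
  rw [← withDensity_apply _ hS.measurableSet.compl, Set.compl_eq_univ_sdiff]
  exact hlt.le

lemma exists_hMul_mem_compl {S : Set (Heis n)} (hS : IsCompact S) (c : ℝ) :
    ∃ L : ℝ, 1 ≤ L ∧ ∀ ξ ∉ Metric.closedBall (0 : Heis n) L, ∀ η ∈ hBox n c, hMul ξ η ∈ Sᶜ := by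
  have hcomp : IsCompact ((fun p : Heis n × Heis n => hMul p.1 (-p.2)) '' (S ×ˢ hBox n c)) :=
    (hS.prod (isCompact_hBox c)).image
      (continuous_hMul.comp (continuous_fst.prodMk continuous_snd.neg))
  obtain ⟨L, hL⟩ := hcomp.isBounded.subset_closedBall 0
  refine ⟨max L 1, le_max_right _ _, fun ξ hξ η hη hmem => hξ ?_⟩
  refine Metric.closedBall_subset_closedBall (le_max_left L 1) (hL ⟨(hMul ξ η, η), ⟨hmem, hη⟩, ?_⟩)
  exact hMul_neg_cancel_right ξ η

/-- Exponential decay of the measure of the superlevel sets near infinity. -/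
lemma exists_volume_superlevel_le (hn : 1 ≤ n) : ∃ A D : ℝ≥0∞, A ≠ ⊤ ∧ D ≠ ⊤ ∧
    ∀ u : Heis n → ℝ, ContDiff ℝ 1 u →
      ∫⁻ ξ, (hGrad u ξ ^ (2 * n + 2) + ‖u ξ‖ₑ ^ (2 * n + 2)) ≠ ⊤ →
      ∀ ε : ℝ≥0∞, ε ≠ 0 → ε ≠ ⊤ → ∃ L : ℝ, 1 ≤ L ∧ ∀ K : ℕ, 1 ≤ K →
        volume {ξ | ξ ∉ Metric.closedBall 0 L ∧
          A * (K : ℝ≥0∞) ^ ((2 * (n : ℝ) + 1) / (2 * n + 2)) * ε < ‖u ξ‖ₑ} ≤ D * 2⁻¹ ^ K := by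
  obtain ⟨C, c, hC, hc, hrep⟩ := exists_enorm_le_mean_add_potential hn
  obtain ⟨m, hm⟩ : ∃ m, m = 2 * n + 1 := ⟨_, rfl⟩
  have hm1 : 1 ≤ m := by omega
  have hcast : (2 * (n : ℝ) + 1) / (2 * n + 2) = (m : ℝ) / (m + 1) := by
    rw [hm]
    push_cast
    ring_nf
  have hexp : 2 * n + 2 = m + 1 := by omega
  set θ : ℝ := (m : ℝ) / (m + 1) with hθ
  have hθ0 : 0 ≤ θ := by positivity
  set B : ℕ → Set (Heis n) := fun k => hBox n (c * (1 / 2) ^ k) with hBdef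
  set v : ℝ≥0∞ := ENNReal.ofReal (2 ^ (2 * n + 1) * c ^ (2 * n + 2)) with hvdef
  have hB : ∀ k, MeasurableSet (B k) := fun k => measurableSet_hBox _
  have hBsub : ∀ k, B k ⊆ hBox n c := fun k => hBox_mono (by positivity)
    (mul_le_of_le_one_right (by positivity) (pow_le_one₀ (by norm_num) (by norm_num)))
  have hv : ∀ k, 2 ^ (k * (m + 1)) * volume (B k) ≤ v := fun k => by
    rw [hBdef, volume_hBox (by positivity), hvdef, ← hexp]
    rw [show (2 : ℝ≥0∞) = ENNReal.ofReal 2 by simp, ← ENNReal.ofReal_pow (by norm_num),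
      ← ENNReal.ofReal_mul (by positivity)]
    refine ENNReal.ofReal_le_ofReal (le_of_eq ?_)
    rw [mul_pow, ← pow_mul, one_div, inv_pow]
    field_simp
  have hvtop : v ≠ ⊤ := ENNReal.ofReal_ne_top
  refine ⟨ENNReal.ofReal C * (2 * (4 * v) ^ θ + 1), (2 * v) ^ (m + 1), ?_, ?_, ?_⟩
  · finiteness
  · finiteness
  intro u hu hfin ε hε hεtop
  rw [hcast]
  simp only [hexp] at hfin
  have hGm := measurable_hGrad hu
  have hUm : Measurable fun ξ => ‖u ξ‖ₑ := hu.continuous.measurable.enorm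
  obtain ⟨S, hS, hSle⟩ := exists_isCompact_setLIntegral_compl_le hfin (ε := ε ^ (m + 1))
    (pow_ne_zero _ hε)
  have hSm : MeasurableSet Sᶜ := hS.measurableSet.compl
  obtain ⟨L, hL1, hL⟩ := exists_hMul_mem_compl hS c
  have hsmall : ∀ f : Heis n → ℝ≥0∞,
      (∀ ξ, f ξ ^ (m + 1) ≤ hGrad u ξ ^ (m + 1) + ‖u ξ‖ₑ ^ (m + 1)) →
      ∫⁻ ξ, Sᶜ.indicator f ξ ^ (m + 1) ≤ ε ^ (m + 1) := fun f hf => by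
    refine le_trans ?_ hSle
    rw [← lintegral_indicator hSm]
    refine lintegral_mono fun ξ => ?_
    by_cases hξ : ξ ∈ Sᶜ
    · simpa only [Set.indicator_of_mem hξ] using hf ξ
    · simp only [Set.indicator_of_notMem hξ]
      simp
  have hout : ∀ (f : Heis n → ℝ≥0∞) (k : ℕ), ∀ ξ ∉ Metric.closedBall (0 : Heis n) L,
      ∫⁻ η in B k, f (hMul ξ η) = ∫⁻ η in B k, Sᶜ.indicator f (hMul ξ η) := fun f k ξ hξ =>
    setLIntegral_congr_fun (hB k) fun η hη =>
      (Set.indicator_of_mem (hL ξ hξ η (hBsub k hη)) f).symm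
  have hholder : ∀ (f : Heis n → ℝ≥0∞), Measurable f →
      (∀ ξ, f ξ ^ (m + 1) ≤ hGrad u ξ ^ (m + 1) + ‖u ξ‖ₑ ^ (m + 1)) → ∀ (K : ℕ) (ξ : Heis n),
      ∑ k ∈ Finset.range K, 2 ^ (k * m) * ∫⁻ η in B k, Sᶜ.indicator f (hMul ξ η) ≤
        (4 * v) ^ θ * K ^ θ * ε := fun f hfm hf K ξ => by
    refine (sum_mul_setLIntegral_le hm1 hB hv
      ((hfm.indicator hSm).comp (continuous_hMul_left ξ).measurable) K).trans ?_
    rw [← ENNReal.mul_rpow_of_nonneg _ _ hθ0, mul_assoc 4 v, mul_comm v]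
    gcongr
    have h1 : ∫⁻ η, (Sᶜ.indicator f ∘ hMul ξ) η ^ (m + 1) ≤ ε ^ (m + 1) := by
      refine le_trans (le_of_eq ?_) (hsmall f hf)
      exact (measurePreserving_hMul_left ξ).lintegral_comp
        (f := fun η => Sᶜ.indicator f η ^ (m + 1)) ((hfm.indicator hSm).pow_const _)
    refine (ENNReal.rpow_le_rpow h1 (by positivity)).trans (le_of_eq ?_)
    rw [← ENNReal.rpow_natCast, ← ENNReal.rpow_mul]
    push_cast
    rw [mul_one_div_cancel (by positivity), ENNReal.rpow_one]
  refine ⟨L, hL1, fun K hK => ?_⟩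
  set T : Heis n → ℝ≥0∞ := fun ξ =>
    ∑' k, 2 ^ ((k + K) * m) * ∫⁻ η in B (k + K), Sᶜ.indicator (hGrad u) (hMul ξ η) with hT
  have hTm : Measurable T := by
    refine Measurable.tsum fun k => Measurable.const_mul ?_ _
    exact (((hGm.indicator hSm).comp continuous_hMul.measurable).lintegral_prod_right'
      (ν := volume.restrict (B (k + K))))
  have hKθ : (1 : ℝ≥0∞) ≤ (K : ℝ≥0∞) ^ θ :=
    ENNReal.one_le_rpow (by exact_mod_cast hK) (by positivity)
  have hsub : {ξ | ξ ∉ Metric.closedBall 0 L ∧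
      ENNReal.ofReal C * (2 * (4 * v) ^ θ + 1) * (K : ℝ≥0∞) ^ θ * ε < ‖u ξ‖ₑ} ⊆
      {ξ | ε ^ (m + 1) ≤ T ξ ^ (m + 1)} := by
    rintro ξ ⟨hξ, hlt⟩
    by_contra hcon
    have hTε : T ξ ≤ ε := by
      by_contra h
      exact hcon (by simp only [Set.mem_ofPred_eq]; gcongr; exact (not_le.1 h).le)
    refine absurd hlt (not_lt.2 ((hrep u hu ξ).trans ?_))
    have hmean : ∫⁻ η in hBox n c, ‖u (hMul ξ η)‖ₑ ≤ (4 * v) ^ θ * (K : ℝ≥0∞) ^ θ * ε := by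
      have h := hholder _ hUm (fun ξ => le_add_self) 1 ξ
      rw [Finset.sum_range_one, zero_mul, pow_zero, one_mul, ← hout _ 0 ξ hξ] at h
      simp only [hBdef, pow_zero, mul_one, Nat.cast_one, ENNReal.one_rpow] at h
      refine h.trans ?_
      rw [mul_assoc ((4 * v) ^ θ)]
      gcongr
      exact le_mul_of_one_le_left' hKθ
    have hpot : ∑' k : ℕ, ENNReal.ofReal ((2 ^ k) ^ (2 * n + 1)) *
        ∫⁻ η in hBox n (c * (1 / 2) ^ k), hGrad u (hMul ξ η) ≤
        (4 * v) ^ θ * (K : ℝ≥0∞) ^ θ * ε + T ξ := by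
      have hterm : ∀ k : ℕ, ENNReal.ofReal ((2 ^ k) ^ (2 * n + 1)) *
          ∫⁻ η in hBox n (c * (1 / 2) ^ k), hGrad u (hMul ξ η) =
          2 ^ (k * m) * ∫⁻ η in B k, Sᶜ.indicator (hGrad u) (hMul ξ η) := fun k => by
        rw [← hout _ k ξ hξ, ← hm, ← pow_mul, ENNReal.ofReal_pow (by norm_num),
          ENNReal.ofReal_ofNat]
      have hsplit := Summable.sum_add_tsum_nat_add' (k := K) (f := fun k =>
        2 ^ (k * m) * ∫⁻ η in B k, Sᶜ.indicator (hGrad u) (hMul ξ η)) ENNReal.summable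
      rw [tsum_congr hterm, ← hsplit]
      gcongr
      exact hholder _ hGm (fun ξ => le_self_add) K ξ
    calc _ ≤ ENNReal.ofReal C * ((4 * v) ^ θ * (K : ℝ≥0∞) ^ θ * ε) +
          ENNReal.ofReal C * ((4 * v) ^ θ * (K : ℝ≥0∞) ^ θ * ε + 1 * ε) := by
          gcongr
          exact hpot.trans (by gcongr; rwa [one_mul])
      _ ≤ ENNReal.ofReal C * ((4 * v) ^ θ * (K : ℝ≥0∞) ^ θ * ε) +
          ENNReal.ofReal C * ((4 * v) ^ θ * (K : ℝ≥0∞) ^ θ * ε + (K : ℝ≥0∞) ^ θ * ε) := by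
          gcongr
      _ = _ := by ring
  have hε0 : ε ^ (m + 1) ≠ 0 := pow_ne_zero _ hε
  have hεt : ε ^ (m + 1) ≠ ⊤ := ENNReal.pow_ne_top hεtop
  calc _ ≤ volume {ξ | ε ^ (m + 1) ≤ T ξ ^ (m + 1)} := measure_mono hsub
    _ ≤ (∫⁻ ξ, T ξ ^ (m + 1)) / ε ^ (m + 1) :=
        meas_ge_le_lintegral_div (hTm.pow_const _).aemeasurable hε0 hεt
    _ ≤ ((2 * v * 2⁻¹ ^ K) ^ (m + 1) * ε ^ (m + 1)) / ε ^ (m + 1) := by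
        gcongr
        refine (lintegral_tail_potential_pow_le hm1 hB hv (hGm.indicator hSm) K).trans ?_
        gcongr
        exact hsmall _ fun ξ => le_self_add
    _ = (2 * v) ^ (m + 1) * (2⁻¹ ^ K) ^ (m + 1) := by
        rw [ENNReal.mul_div_cancel_right hε0 hεt, mul_pow]
    _ ≤ (2 * v) ^ (m + 1) * 2⁻¹ ^ K := by
        refine mul_le_mul' le_rfl (pow_le_of_le_one zero_le ?_ m.succ_ne_zero)
        exact pow_le_one₀ zero_le (ENNReal.inv_le_one.2 one_le_two)

end Decay

section SingularWeight

variable {n : ℕ}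

lemma integrableOn_abs_rpow_neg {s : ℝ} (hs : s < 1) (L : ℝ) :
    IntegrableOn (fun x : ℝ => |x| ^ (-s)) (Metric.closedBall 0 L) := by
  have h := (intervalIntegral.intervalIntegrable_cpow' (a := 0 - L) (b := 0 + L)
    (r := ((-s : ℝ) : ℂ)) (by rw [Complex.ofReal_re]; linarith)).norm
  simp only [Complex.norm_cpow_real, Complex.norm_real, Real.norm_eq_abs] at h
  rw [Real.closedBall_eq_Icc]
  rcases le_or_gt 0 L with hL | hL
  · exact (intervalIntegrable_iff_integrableOn_Icc_of_le (by linarith)).1 h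
  · rw [Set.Icc_eq_empty (by linarith)]
    exact integrableOn_empty

lemma integrableOn_prod_abs_rpow_neg {s : ℝ} (hs : s < 1) {L : ℝ} (hL : 0 ≤ L) :
    IntegrableOn (fun ξ : Heis n =>
        (∏ i, |ξ.1 i| ^ (-s)) * ((∏ i, |ξ.2.1 i| ^ (-s)) * |ξ.2.2| ^ (-s)))
      (Metric.closedBall 0 L) := by
  have hpi : IntegrableOn (fun x : Fin n → ℝ => ∏ i, |x i| ^ (-s)) (Metric.closedBall 0 L) := by
    rw [IntegrableOn, closedBall_pi _ hL, volume_pi, Measure.restrict_pi_pi]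
    exact Integrable.fintype_prod fun _ => integrableOn_abs_rpow_neg hs L
  have h := Integrable.mul_prod hpi (Integrable.mul_prod hpi (integrableOn_abs_rpow_neg hs L))
  rwa [Measure.prod_restrict, Measure.prod_restrict, closedBall_prod_same, closedBall_prod_same]
    at h

lemma hNorm_pow_four (ξ : Heis n) :
    hNorm ξ ^ 4 = (∑ i, ((ξ.1 i) ^ 2 + (ξ.2.1 i) ^ 2)) ^ 2 + (ξ.2.2) ^ 2 := by
  rw [hNorm, ← Real.rpow_natCast, ← Real.rpow_mul (by positivity)]
  norm_num

lemma hNorm_nonneg (ξ : Heis n) : 0 ≤ hNorm ξ := by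
  rw [hNorm]
  positivity

lemma sq_add_sq_le_hNorm_sq (ξ : Heis n) (i : Fin n) :
    (ξ.1 i) ^ 2 + (ξ.2.1 i) ^ 2 ≤ hNorm ξ ^ 2 := by
  refine (Finset.single_le_sum (f := fun i => (ξ.1 i) ^ 2 + (ξ.2.1 i) ^ 2)
    (fun i _ => by positivity) (Finset.mem_univ i)).trans ?_
  refine le_of_sq_le_sq ?_ (by positivity)
  rw [← pow_mul, hNorm_pow_four]
  exact le_add_of_nonneg_right (sq_nonneg _)

lemma abs_fst_le_hNorm (ξ : Heis n) (i : Fin n) : |ξ.1 i| ≤ hNorm ξ :=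
  abs_le_of_sq_le_sq (by linarith [sq_add_sq_le_hNorm_sq ξ i, sq_nonneg (ξ.2.1 i)])
    (hNorm_nonneg ξ)

lemma abs_snd_le_hNorm (ξ : Heis n) (i : Fin n) : |ξ.2.1 i| ≤ hNorm ξ :=
  abs_le_of_sq_le_sq (by linarith [sq_add_sq_le_hNorm_sq ξ i, sq_nonneg (ξ.1 i)])
    (hNorm_nonneg ξ)

lemma abs_center_le_hNorm_sq (ξ : Heis n) : |ξ.2.2| ≤ hNorm ξ ^ 2 := by
  refine abs_le_of_sq_le_sq ?_ (by positivity)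
  rw [← pow_mul, hNorm_pow_four]
  exact le_add_of_nonneg_left (sq_nonneg _)

lemma one_le_hNorm {L : ℝ} (hL : 1 ≤ L) {ξ : Heis n} (hξ : ξ ∉ Metric.closedBall 0 L) :
    1 ≤ hNorm ξ := by
  by_contra! h
  refine hξ (mem_closedBall_zero_iff.2 ?_)
  have h0 := hNorm_nonneg ξ
  refine le_trans ?_ hL
  rw [norm_prod_le_iff, norm_prod_le_iff, pi_norm_le_iff_of_nonneg zero_le_one,
    pi_norm_le_iff_of_nonneg zero_le_one]
  exact ⟨fun i => (abs_fst_le_hNorm ξ i).trans h.le, fun i => (abs_snd_le_hNorm ξ i).trans h.le,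
    (abs_center_le_hNorm_sq ξ).trans (pow_le_one₀ h0 h.le)⟩

lemma hNorm_rpow_neg_le {s : ℝ} (hs : 0 ≤ s) {ξ : Heis n} (hx : ∀ i, ξ.1 i ≠ 0)
    (hy : ∀ i, ξ.2.1 i ≠ 0) (ht : ξ.2.2 ≠ 0) :
    hNorm ξ ^ (-(s * (2 * n + 2))) ≤
      (∏ i, |ξ.1 i| ^ (-s)) * ((∏ i, |ξ.2.1 i| ^ (-s)) * |ξ.2.2| ^ (-s)) := by
  have hs' : -s ≤ 0 := by linarith
  have h2 := abs_center_le_hNorm_sq ξ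
  have h0 : 0 < hNorm ξ := (hNorm_nonneg ξ).lt_of_ne fun h => by
    rw [← h] at h2
    exact ht (abs_nonpos_iff.1 (by simpa using h2))
  calc hNorm ξ ^ (-(s * (2 * n + 2)))
      = (∏ _i : Fin n, hNorm ξ ^ (-s)) * ((∏ _i : Fin n, hNorm ξ ^ (-s)) *
          (hNorm ξ ^ 2) ^ (-s)) := by
        simp only [Finset.prod_const, Finset.card_univ, Fintype.card_fin, ← Real.rpow_natCast,
          ← Real.rpow_mul h0.le, ← Real.rpow_add h0]
        congr 1
        push_cast
        ring
    _ ≤ _ := by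
        gcongr ?_ * (?_ * ?_)
        · exact Finset.prod_le_prod (fun _ _ => by positivity) fun i _ =>
            Real.rpow_le_rpow_of_nonpos (abs_pos.2 (hx i)) (abs_fst_le_hNorm ξ i) hs'
        · exact Finset.prod_le_prod (fun _ _ => by positivity) fun i _ =>
            Real.rpow_le_rpow_of_nonpos (abs_pos.2 (hy i)) (abs_snd_le_hNorm ξ i) hs'
        · exact Real.rpow_le_rpow_of_nonpos (abs_pos.2 ht) h2 hs'

lemma setLIntegral_hNorm_rpow_neg_lt_top {β L : ℝ} (hβ0 : 0 ≤ β) (hβ : β < 2 * n + 2)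
    (hL : 0 ≤ L) :
    ∫⁻ ξ in Metric.closedBall (0 : Heis n) L, ENNReal.ofReal (hNorm ξ ^ (-β)) < ⊤ := by
  have hQ : (0 : ℝ) < 2 * n + 2 := by positivity
  have hs0 : 0 ≤ β / (2 * n + 2) := by positivity
  have hs1 : β / (2 * n + 2) < 1 := (div_lt_one hQ).2 hβ
  have h0 : ∀ᵐ x : ℝ, x ≠ 0 := Measure.ae_ne volume 0
  have hi : ∀ i : Fin n, ∀ᵐ x : Fin n → ℝ, x i ≠ 0 := fun i =>
    (Measure.quasiMeasurePreserving_eval (fun _ : Fin n => (volume : Measure ℝ)) i).ae h0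
  have hx : ∀ᵐ ξ : Heis n, ∀ i, ξ.1 i ≠ 0 :=
    Measure.quasiMeasurePreserving_fst.ae (ae_all_iff.2 hi)
  have hy : ∀ᵐ ξ : Heis n, ∀ i, ξ.2.1 i ≠ 0 :=
    (Measure.quasiMeasurePreserving_fst.comp Measure.quasiMeasurePreserving_snd).ae
      (ae_all_iff.2 hi)
  have ht : ∀ᵐ ξ : Heis n, ξ.2.2 ≠ 0 :=
    (Measure.quasiMeasurePreserving_snd.comp Measure.quasiMeasurePreserving_snd).ae h0
  refine lt_of_le_of_lt (lintegral_mono_ae ?_)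
    (integrableOn_prod_abs_rpow_neg (n := n) hs1 hL).lintegral_lt_top
  refine ae_restrict_of_ae ?_
  filter_upwards [hx, hy, ht] with ξ h1 h2 h3
  refine ENNReal.ofReal_le_ofReal ?_
  simpa only [div_mul_cancel₀ _ hQ.ne'] using hNorm_rpow_neg_le hs0 h1 h2 h3

end SingularWeight

section Exponential

variable {n : ℕ}

lemma zeta_le_exp {Q : ℕ} {s : ℝ} (hs : 0 ≤ s) : zeta Q s ≤ Real.exp s :=
  sub_le_self _ (Finset.sum_nonneg fun _ _ => by positivity)

lemma zeta_le_pow_mul_exp {Q : ℕ} {s : ℝ} (hs : 0 ≤ s) :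
    zeta Q s ≤ s ^ (Q - 1) * Real.exp s := by
  have h := Complex.norm_exp_sub_sum_le_norm_mul_exp (s : ℂ) (Q - 1)
  rw [Complex.norm_real, Real.norm_of_nonneg hs] at h
  refine le_trans (le_trans (le_abs_self _) (le_of_eq ?_)) h
  rw [← Real.norm_eq_abs, ← Complex.norm_real]
  simp [zeta]

/-- The exponential remainder is controlled by the power where the argument is small and by a sum
over unit layers where it is large. -/
lemma ofReal_zeta_le {m : ℕ} (hm : 1 ≤ m) {α : ℝ} (hα : 0 ≤ α) (w : ℝ) :
    ENNReal.ofReal (zeta (m + 1) (α * |w| ^ (((m : ℝ) + 1) / m))) ≤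
      ENNReal.ofReal (α ^ m * Real.exp α) * ‖w‖ₑ ^ (m + 1) +
        ∑' k : ℕ, {w : ℝ | ((k : ℝ≥0∞) + 1) ^ ((m : ℝ) / (m + 1)) < ‖w‖ₑ}.indicator
          (fun _ => ENNReal.ofReal (Real.exp α) ^ (k + 2)) w := by
  have hm0 : (0 : ℝ) < m := by exact_mod_cast hm
  set p : ℝ := |w| ^ (((m : ℝ) + 1) / m) with hp
  have hp0 : 0 ≤ p := by positivity
  rcases le_or_gt p 1 with h1 | h1
  · refine le_add_right ?_
    rw [Real.enorm_eq_ofReal_abs, ← ENNReal.ofReal_pow (abs_nonneg w),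
      ← ENNReal.ofReal_mul (by positivity)]
    refine ENNReal.ofReal_le_ofReal ((zeta_le_pow_mul_exp (by positivity)).trans ?_)
    have hpw : p ^ m = |w| ^ (m + 1) := by
      rw [hp, ← Real.rpow_natCast, ← Real.rpow_natCast, ← Real.rpow_mul (abs_nonneg w),
        div_mul_cancel₀ _ hm0.ne']
      push_cast
      rfl
    rw [Nat.add_sub_cancel, mul_pow, hpw, mul_right_comm]
    gcongr
    exact mul_le_of_le_one_right hα h1
  · refine le_add_left ?_
    obtain ⟨k, hk⟩ : ∃ k : ℕ, ⌈p⌉₊ = k + 2 := ⟨⌈p⌉₊ - 2, by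
      have : 1 < ⌈p⌉₊ := Nat.lt_ceil.2 (by exact_mod_cast h1)
      omega⟩
    have hlow : (k : ℝ) + 1 < p := by
      have : k + 1 < ⌈p⌉₊ := by omega
      exact_mod_cast Nat.lt_ceil.1 this
    have hup : p ≤ k + 2 := by
      have := Nat.le_ceil p
      rw [hk] at this
      exact_mod_cast this
    have hcond : w ∈ {w : ℝ | ((k : ℝ≥0∞) + 1) ^ ((m : ℝ) / (m + 1)) < ‖w‖ₑ} := by
      have hk1 : ((k : ℝ≥0∞) + 1) = ENNReal.ofReal ((k : ℝ) + 1) := by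
        rw [ENNReal.ofReal_add (by positivity) zero_le_one, ENNReal.ofReal_natCast,
          ENNReal.ofReal_one]
      have hw : ((m : ℝ) + 1) / m * (m / (m + 1)) = 1 := by field_simp
      rw [Set.mem_ofPred_eq, hk1, ENNReal.ofReal_rpow_of_pos (by positivity),
        Real.enorm_eq_ofReal_abs]
      refine (ENNReal.ofReal_lt_ofReal_iff_of_nonneg (by positivity)).2 ?_
      calc ((k : ℝ) + 1) ^ ((m : ℝ) / (m + 1)) < p ^ ((m : ℝ) / (m + 1)) :=
            Real.rpow_lt_rpow (by positivity) hlow (by positivity)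
        _ = |w| := by rw [hp, ← Real.rpow_mul (abs_nonneg w), hw, Real.rpow_one]
    refine le_trans ?_ (ENNReal.le_tsum k)
    rw [Set.indicator_of_mem hcond, ← ENNReal.ofReal_pow (Real.exp_pos _).le, ← Real.exp_nat_mul]
    refine ENNReal.ofReal_le_ofReal ((zeta_le_exp (by positivity)).trans ?_)
    rw [Real.exp_le_exp, mul_comm]
    push_cast
    gcongr

lemma exists_setLIntegral_compl_zeta_lt_top (hn : 1 ≤ n) {α : ℝ} (hα : 0 ≤ α) {u : Heis n → ℝ}
    (hu : ContDiff ℝ 1 u)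
    (hfin : ∫⁻ ξ, (hGrad u ξ ^ (2 * n + 2) + ‖u ξ‖ₑ ^ (2 * n + 2)) ≠ ⊤) :
    ∃ L : ℝ, 1 ≤ L ∧ ∫⁻ ξ in (Metric.closedBall 0 L)ᶜ,
      ENNReal.ofReal (zeta (2 * n + 2) (α * |u ξ| ^ ((2 * (n : ℝ) + 2) / (2 * n + 1)))) < ⊤ := by
  obtain ⟨A, D, hA, hD, hdecay⟩ := exists_volume_superlevel_le hn
  set θ : ℝ := (2 * (n : ℝ) + 1) / (2 * n + 2) with hθ
  have hθ0 : 0 ≤ θ := by positivity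
  set E : ℝ≥0∞ := ENNReal.ofReal (Real.exp α) with hE
  have hE0 : E ≠ 0 := by simp [hE, Real.exp_pos]
  have hEt : E ≠ ⊤ := ENNReal.ofReal_ne_top
  obtain ⟨N, hN1, hN⟩ : ∃ N : ℕ, 1 ≤ N ∧ E * 2⁻¹ ^ N ≤ 2⁻¹ := by
    obtain ⟨N, hN⟩ := ENNReal.exists_inv_two_pow_lt (ENNReal.inv_ne_zero.2 hEt)
    refine ⟨N + 1, by omega, ?_⟩
    calc E * 2⁻¹ ^ (N + 1) ≤ E * (E⁻¹ * 2⁻¹) := by rw [pow_succ]; gcongr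
      _ = 2⁻¹ := by rw [← mul_assoc, ENNReal.mul_inv_cancel hE0 hEt, one_mul]
  have hAN : A * (N : ℝ≥0∞) ^ θ + 1 ≠ ⊤ := by finiteness
  obtain ⟨L, hL1, hL⟩ := hdecay u hu hfin (A * (N : ℝ≥0∞) ^ θ + 1)⁻¹ (ENNReal.inv_ne_zero.2 hAN)
    (ENNReal.inv_ne_top.2 (by simp))
  refine ⟨L, hL1, ?_⟩
  have hUm : Measurable fun ξ => ‖u ξ‖ₑ := hu.continuous.measurable.enorm
  have hlevel : ∀ k : ℕ, volume {ξ | ξ ∉ Metric.closedBall 0 L ∧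
      ((k : ℝ≥0∞) + 1) ^ θ < ‖u ξ‖ₑ} ≤ D * (2⁻¹ ^ N) ^ (k + 1) := fun k => by
    rw [← pow_mul]
    refine (measure_mono ?_).trans (hL (N * (k + 1)) (Nat.mul_pos hN1 k.succ_pos))
    rintro ξ ⟨hξ, hlt⟩
    refine ⟨hξ, lt_of_le_of_lt ?_ hlt⟩
    push_cast
    rw [ENNReal.mul_rpow_of_nonneg _ _ hθ0, ← mul_assoc, mul_right_comm]
    refine mul_le_of_le_one_left zero_le ?_
    rw [← div_eq_mul_inv]
    exact ENNReal.div_le_of_le_mul (by rw [one_mul]; exact le_self_add)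
  have hsetm : ∀ k : ℕ, MeasurableSet {ξ | ((k : ℝ≥0∞) + 1) ^ θ < ‖u ξ‖ₑ} := fun k =>
    measurableSet_lt measurable_const hUm
  have hUfin : ∫⁻ ξ, ‖u ξ‖ₑ ^ (2 * n + 2) < ⊤ :=
    (lintegral_mono fun ξ => le_add_self).trans_lt hfin.lt_top
  have hpt : ∀ ξ, ENNReal.ofReal
      (zeta (2 * n + 2) (α * |u ξ| ^ ((2 * (n : ℝ) + 2) / (2 * n + 1)))) ≤
      ENNReal.ofReal (α ^ (2 * n + 1) * Real.exp α) * ‖u ξ‖ₑ ^ (2 * n + 2) +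
        ∑' k : ℕ, {ξ | ((k : ℝ≥0∞) + 1) ^ θ < ‖u ξ‖ₑ}.indicator (fun _ => E ^ (k + 2)) ξ :=
    fun ξ => by
    have h := ofReal_zeta_le (m := 2 * n + 1) (by omega) hα (u ξ)
    have hcast : ((2 * n + 1 : ℕ) : ℝ) + 1 = 2 * n + 2 := by push_cast; ring
    have hcast' : ((2 * n + 1 : ℕ) : ℝ) = 2 * n + 1 := by push_cast; ring
    rw [hcast, hcast'] at h
    exact h
  calc _ ≤ ∫⁻ ξ in (Metric.closedBall 0 L)ᶜ,
        (ENNReal.ofReal (α ^ (2 * n + 1) * Real.exp α) * ‖u ξ‖ₑ ^ (2 * n + 2) +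
        ∑' k : ℕ, {ξ | ((k : ℝ≥0∞) + 1) ^ θ < ‖u ξ‖ₑ}.indicator (fun _ => E ^ (k + 2)) ξ) :=
        lintegral_mono hpt
    _ = ENNReal.ofReal (α ^ (2 * n + 1) * Real.exp α) *
          (∫⁻ ξ in (Metric.closedBall 0 L)ᶜ, ‖u ξ‖ₑ ^ (2 * n + 2)) +
        ∑' k : ℕ, E ^ (k + 2) * volume {ξ | ξ ∉ Metric.closedBall 0 L ∧
          ((k : ℝ≥0∞) + 1) ^ θ < ‖u ξ‖ₑ} := by
        rw [lintegral_add_left ((hUm.pow_const _).const_mul _),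
          lintegral_const_mul _ (hUm.pow_const _),
          lintegral_tsum fun k => (measurable_const.indicator (hsetm k)).aemeasurable]
        congr 1
        refine tsum_congr fun k => ?_
        rw [lintegral_indicator_const (hsetm k), Measure.restrict_apply (hsetm k)]
        congr 2
        ext ξ
        exact and_comm
    _ ≤ ENNReal.ofReal (α ^ (2 * n + 1) * Real.exp α) * (∫⁻ ξ, ‖u ξ‖ₑ ^ (2 * n + 2)) +
        ∑' k : ℕ, E * D * 2⁻¹ * 2⁻¹ ^ k := by
        refine add_le_add (mul_le_mul' le_rfl (setLIntegral_le_lintegral _ _))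
          (ENNReal.tsum_le_tsum fun k => ?_)
        calc _ ≤ E ^ (k + 2) * (D * (2⁻¹ ^ N) ^ (k + 1)) := by gcongr; exact hlevel k
          _ = E * D * (E * 2⁻¹ ^ N) ^ (k + 1) := by ring
          _ ≤ E * D * 2⁻¹ ^ (k + 1) := by gcongr
          _ = _ := by ring
    _ < ⊤ := by
        rw [ENNReal.tsum_mul_left, ENNReal.tsum_geometric, ENNReal.one_sub_inv_two, inv_inv]
        have := hUfin.ne
        finiteness

end Exponential

/-- Finiteness (4.13): for any `0 ≤ β < Q` and any `α > 0`, a smooth function with finite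
`W^{1,Q}`-norm has finite singular Trudinger–Moser integral. -/
theorem trudinger_moser_integral_finite (n : ℕ) (hn : 1 ≤ n) (β α : ℝ)
    (hβ0 : 0 ≤ β) (hβ : β < 2 * n + 2) (hα : 0 < α)
    (u : Heis n → ℝ) (hu : ContDiff ℝ (⊤ : ℕ∞) u)
    (hfin : ∫⁻ ξ, ENNReal.ofReal (hGradNorm u ξ ^ (2 * n + 2) + |u ξ| ^ (2 * n + 2)) < ⊤) :
    ∫⁻ ξ, ENNReal.ofReal ((hNorm ξ) ^ (-β) *
        zeta (2 * n + 2) (α * |u ξ| ^ ((2 * (n : ℝ) + 2) / (2 * n + 1)))) < ⊤ := by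
  have hu1 : ContDiff ℝ 1 u := hu.of_le (by exact_mod_cast le_top)
  have hfin' : ∫⁻ ξ, (hGrad u ξ ^ (2 * n + 2) + ‖u ξ‖ₑ ^ (2 * n + 2)) ≠ ⊤ := by
    refine ne_of_eq_of_ne (lintegral_congr fun ξ => ?_) hfin.ne
    have hG : 0 ≤ hGradNorm u ξ := Real.sqrt_nonneg _
    rw [hGrad, Real.enorm_eq_ofReal_abs, ENNReal.ofReal_add (by positivity) (by positivity),
      ENNReal.ofReal_pow hG, ENNReal.ofReal_pow (abs_nonneg _)]
  obtain ⟨L, hL1, hL⟩ := exists_setLIntegral_compl_zeta_lt_top hn hα.le hu1 hfin'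
  have hL0 : 0 ≤ L := zero_le_one.trans hL1
  rw [← lintegral_add_compl _
    (Metric.isClosed_closedBall (x := (0 : Heis n)) (ε := L)).measurableSet]
  refine ENNReal.add_lt_top.2 ⟨?_, ?_⟩
  · obtain ⟨M, hM⟩ := (isCompact_closedBall (0 : Heis n) L).exists_bound_of_continuousOn
      hu.continuous.continuousOn
    calc _ ≤ ∫⁻ ξ in Metric.closedBall 0 L, ENNReal.ofReal (hNorm ξ ^ (-β)) *
          ENNReal.ofReal (Real.exp (α * M ^ ((2 * (n : ℝ) + 2) / (2 * n + 1)))) := by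
          refine setLIntegral_mono' Metric.isClosed_closedBall.measurableSet fun ξ hξ => ?_
          rw [ENNReal.ofReal_mul (Real.rpow_nonneg (hNorm_nonneg ξ) _)]
          gcongr
          refine (zeta_le_exp (by positivity)).trans ?_
          gcongr
          exact hM ξ hξ
      _ < ⊤ := by
          rw [lintegral_mul_const' _ _ ENNReal.ofReal_ne_top]
          exact ENNReal.mul_lt_top (setLIntegral_hNorm_rpow_neg_lt_top hβ0 hβ hL0)
            ENNReal.ofReal_lt_top
  · refine lt_of_le_of_lt
      (setLIntegral_mono' Metric.isClosed_closedBall.measurableSet.compl fun ξ hξ => ?_) hL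
    rw [ENNReal.ofReal_mul (Real.rpow_nonneg (hNorm_nonneg ξ) _)]
    refine mul_le_of_le_one_left zero_le (ENNReal.ofReal_le_one.2 ?_)
    exact Real.rpow_le_one_of_one_le_of_nonpos (one_le_hNorm hL1 hξ) (neg_nonpos.2 hβ0)
end
end
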